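/- There exists an absolute constant C > 0 with the following property: for every odd prime p and every Dirichlet character χ modulo p with χ² = χ₀ (χ principal or the quadratic character), if for every Dirichlet character ψ modulo p every zero s of L(s,ψ) with 0 < Re(s) < 1 satisfies Re(s) = 1/2, then for all real x ≥ 8 one has | ∑_{m ∈ S, m ≤ x} χ(m) − ∑_{r ≤ x^{1/3}, r prime} χ(r) · Li(x^{1/2}/r^{3/2}) | ≤ C · x^{1/3} · log x, where Li(y) = ∫_2^y dt/log t (taken as 0 for y ≤ 2). -/

import Mathlib

/-- The logarithmic integral `Li(y) = ∫_2^y dt / log t`, taken to be `0` for `y ≤ 2`. -/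
noncomputable def Li (y : ℝ) : ℝ := if y ≤ 2 then 0 else ∫ t in (2 : ℝ)..y, 1 / Real.log t

/-- `S` is the set of positive integers of the form `q² r³` with `q, r` prime. -/
def memS (m : ℕ) : Prop := ∃ q r : ℕ, q.Prime ∧ r.Prime ∧ m = q ^ 2 * r ^ 3

section

open Complex MeasureTheory Set Filter Topology Asymptotics

/-- The entire function `(s - 1) ζ(s)`, with value `1` at `s = 1`. -/
noncomputable def regZeta : ℂ → ℂ := Function.update (fun s ↦ (s - 1) * riemannZeta s) 1 1

lemma regZeta_of_ne_one {s : ℂ} (hs : s ≠ 1) : regZeta s = (s - 1) * riemannZeta s :=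
  Function.update_of_ne hs ..

lemma regZeta_one : regZeta 1 = 1 := Function.update_self ..

lemma differentiable_regZeta : Differentiable ℂ regZeta := by
  have h := DirichletCharacter.differentiable_LFunctionTrivChar₁ 1
  have heq : DirichletCharacter.LFunctionTrivChar₁ 1 = regZeta := by
    simp [DirichletCharacter.LFunctionTrivChar₁, regZeta, DirichletCharacter.LFunctionTrivChar,
      DirichletCharacter.LFunction_modOne_eq]
  rwa [heq] at h

/-- The fractional part function, restricted to `(1, ∞)`. -/
noncomputable def fractIoi : ℝ → ℂ := (Ioi (1 : ℝ)).indicator fun t ↦ ((Int.fract t : ℝ) : ℂ)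

lemma norm_fractIoi_le (t : ℝ) : ‖fractIoi t‖ ≤ 1 := by
  refine (norm_indicator_le_norm_self _ _).trans ?_
  rw [norm_real, Real.norm_of_nonneg (Int.fract_nonneg t)]
  exact (Int.fract_lt_one t).le

lemma locallyIntegrable_fractIoi : LocallyIntegrable fractIoi := by
  refine (locallyIntegrable_const (1 : ℝ)).mono ?_ (.of_forall fun t ↦ by
    simpa using norm_fractIoi_le t)
  exact ((measurable_ofReal.comp measurable_fract).indicator measurableSet_Ioi).aestronglyMeasurable

lemma mellinConvergent_fractIoi {s : ℂ} (hs : s.re < 0) :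
    MellinConvergent fractIoi s ∧ DifferentiableAt ℂ (mellin fractIoi) s := by
  have h0 : fractIoi =O[𝓝[>] 0] (fun t : ℝ ↦ t ^ (-(s.re - 1))) := by
    refine Filter.EventuallyEq.trans_isBigO ?_ (isBigO_zero _ _)
    have : ∀ᶠ t : ℝ in 𝓝[>] 0, t < 1 :=
      mem_nhdsWithin_of_mem_nhds (Iio_mem_nhds (by norm_num))
    filter_upwards [this] with t ht
    simp [fractIoi, ht.le]
  have h1 : fractIoi =O[atTop] (fun t : ℝ ↦ t ^ (-(0 : ℝ))) := by
    simp only [neg_zero, Real.rpow_zero]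
    exact IsBigO.of_bound 1 (.of_forall fun t ↦ by simpa using norm_fractIoi_le t)
  exact ⟨mellinConvergent_of_isBigO_rpow (locallyIntegrable_fractIoi.locallyIntegrableOn _)
    h1 hs h0 (by linarith), mellin_differentiableAt_of_isBigO_rpow
    (locallyIntegrable_fractIoi.locallyIntegrableOn _) h1 hs h0 (by linarith)⟩

lemma mellin_indicator_Ioi_one (f : ℝ → ℂ) (s : ℂ) :
    mellin ((Ioi (1 : ℝ)).indicator f) s = ∫ t in Ioi (1 : ℝ), (t : ℂ) ^ (s - 1) * f t := by
  have h : ∀ t : ℝ, (t : ℂ) ^ (s - 1) • (Ioi (1 : ℝ)).indicator f t =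
      (Ioi (1 : ℝ)).indicator (fun t : ℝ ↦ (t : ℂ) ^ (s - 1) * f t) t := by
    intro t
    by_cases ht : t ∈ Ioi (1 : ℝ) <;> simp [ht]
  rw [mellin]
  simp_rw [h]
  rw [setIntegral_indicator measurableSet_Ioi, Ioi_inter_Ioi, max_eq_right zero_le_one]

lemma mellinConvergent_indicator_Ioi_one {f : ℝ → ℂ} {s : ℂ} :
    MellinConvergent ((Ioi (1 : ℝ)).indicator f) s ↔
      IntegrableOn (fun t : ℝ ↦ (t : ℂ) ^ (s - 1) * f t) (Ioi 1) := by
  have h : ∀ t : ℝ, (t : ℂ) ^ (s - 1) • (Ioi (1 : ℝ)).indicator f t =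
      (Ioi (1 : ℝ)).indicator (fun t : ℝ ↦ (t : ℂ) ^ (s - 1) * f t) t := by
    intro t
    by_cases ht : t ∈ Ioi (1 : ℝ) <;> simp [ht]
  rw [MellinConvergent]
  simp_rw [h]
  rw [IntegrableOn, integrable_indicator_iff measurableSet_Ioi, IntegrableOn,
    Measure.restrict_restrict measurableSet_Ioi, Ioi_inter_Ioi, max_eq_left zero_le_one, IntegrableOn]

lemma regZeta_eq_of_one_lt_re {s : ℂ} (hs : 1 < s.re) :
    regZeta s = s - s * (s - 1) * mellin fractIoi (-s) := by
  have hs1 : s ≠ 1 := by rintro rfl; simp at hs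
  have hs1' : s - 1 ≠ 0 := sub_ne_zero.mpr hs1
  have hz : riemannZeta s = s * ∫ t in Ioi (1 : ℝ), (⌊t⌋₊ : ℂ) * (t : ℂ) ^ (-(s + 1)) := by
    rw [← LSeries_one_eq_riemannZeta hs,
      LSeries_eq_mul_integral 1 zero_le_one hs (LSeriesSummable_one_iff.mpr hs) ?_]
    · simp
    · exact IsBigO.of_bound 1 (.of_forall fun n ↦ by simp)
  have hInt : IntegrableOn (fun t : ℝ ↦ (t : ℂ) ^ (-s)) (Ioi 1) :=
    integrableOn_Ioi_cpow_of_lt (by simpa using hs) one_pos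
  have hfr := mellinConvergent_indicator_Ioi_one.mp
    (mellinConvergent_fractIoi (s := -s) (by simp; linarith)).1
  have hfl : ∀ t ∈ Ioi (1 : ℝ), (⌊t⌋₊ : ℂ) * (t : ℂ) ^ (-(s + 1)) =
      (t : ℂ) ^ (-s) - (t : ℂ) ^ (-s - 1) * ((Int.fract t : ℝ) : ℂ) := by
    intro t ht
    have ht0 : (0 : ℝ) < t := one_pos.trans ht
    have h1 : (⌊t⌋₊ : ℂ) = (t : ℂ) - ((Int.fract t : ℝ) : ℂ) := by
      rw [← ofReal_natCast, natCast_floor_eq_intCast_floor ht0.le, ← ofReal_sub,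
        Int.self_sub_fract]
    have h2 : (t : ℂ) ^ (-s) = (t : ℂ) * (t : ℂ) ^ (-s - 1) := by
      rw [cpow_sub _ _ (by exact_mod_cast ht0.ne'), cpow_one]
      field_simp [show (t : ℂ) ≠ 0 by exact_mod_cast ht0.ne']
    rw [h1, h2, show -(s + 1) = -s - 1 by ring]
    ring
  rw [regZeta_of_ne_one hs1, hz, setIntegral_congr_fun measurableSet_Ioi hfl,
    integral_sub hInt hfr, integral_Ioi_cpow_of_lt (by simpa using hs) one_pos,
    fractIoi, mellin_indicator_Ioi_one, ofReal_one, one_cpow]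
  have : -s + 1 ≠ 0 := by rw [show -s + 1 = -(s - 1) by ring]; exact neg_ne_zero.mpr hs1'
  have h3 : (s - 1) * (-1 / (-s + 1)) = 1 := by
    field_simp
    ring
  linear_combination s * h3

lemma regZeta_eq {s : ℂ} (hs : 0 < s.re) :
    regZeta s = s - s * (s - 1) * mellin fractIoi (-s) := by
  have hopen : IsOpen {z : ℂ | 0 < z.re} := isOpen_lt continuous_const continuous_re
  refine AnalyticOnNhd.eqOn_of_preconnected_of_eventuallyEq (U := {z : ℂ | 0 < z.re})
    (f := regZeta) (g := fun s ↦ s - s * (s - 1) * mellin fractIoi (-s)) (z₀ := 2)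
    (differentiable_regZeta.differentiableOn.analyticOnNhd hopen)
    (DifferentiableOn.analyticOnNhd (fun z hz ↦ ?_) hopen)
    (convex_halfSpace_re_gt 0).isPreconnected (by simp) ?_ hs
  · have := (mellinConvergent_fractIoi (s := -z) (by simpa using hz)).2
    have h2 : DifferentiableAt ℂ (fun z ↦ mellin fractIoi (-z)) z :=
      this.comp z differentiableAt_id.neg
    exact DifferentiableAt.differentiableWithinAt (by fun_prop)
  · have : ∀ᶠ z : ℂ in 𝓝 2, 1 < z.re :=
      (isOpen_lt continuous_const continuous_re).mem_nhds (by simp)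
    filter_upwards [this] with z hz using regZeta_eq_of_one_lt_re hz

lemma norm_mellin_fractIoi_le {s : ℂ} (hs : 0 < s.re) :
    ‖mellin fractIoi (-s)‖ ≤ 1 / s.re := by
  rw [fractIoi, mellin_indicator_Ioi_one]
  have hlt : -s.re - 1 < -1 := by linarith
  have h1 := integral_Ioi_rpow_of_lt hlt one_pos
  calc _ ≤ ∫ t in Ioi (1 : ℝ), t ^ (-s.re - 1) := by
        refine norm_integral_le_of_norm_le (integrableOn_Ioi_rpow_of_lt hlt one_pos) ?_
        refine (ae_restrict_iff' measurableSet_Ioi).mpr (.of_forall fun t ht ↦ ?_)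
        have ht0 : (0 : ℝ) < t := one_pos.trans ht
        rw [norm_mul, norm_cpow_eq_rpow_re_of_pos ht0, norm_real,
          Real.norm_of_nonneg (Int.fract_nonneg t)]
        simpa using mul_le_mul_of_nonneg_left (Int.fract_lt_one t).le
          (Real.rpow_nonneg ht0.le (-s.re - 1))
    _ = 1 / s.re := by
        rw [h1, Real.one_rpow]
        rw [show -s.re - 1 + 1 = -s.re by ring, neg_div_neg_eq]

lemma norm_regZeta_le {s : ℂ} (hs : 1 / 2 ≤ s.re) (hs' : s.re ≤ 4) :
    ‖regZeta s‖ ≤ 36 * (1 + |s.im|) ^ 2 := by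
  have h0 : 0 < s.re := by linarith
  have hn : ‖s‖ ≤ 4 * (1 + |s.im|) := by
    refine (norm_le_abs_re_add_abs_im s).trans ?_
    rw [abs_of_pos h0]
    linarith [abs_nonneg s.im]
  have hn1 : ‖s - 1‖ ≤ 4 * (1 + |s.im|) := by
    refine (norm_le_abs_re_add_abs_im _).trans ?_
    have : |(s - 1).re| ≤ 3 := by rw [abs_le]; constructor <;> simp <;> linarith
    simp only [sub_im, one_im, sub_zero]
    linarith [abs_nonneg s.im]
  have hm : ‖mellin fractIoi (-s)‖ ≤ 2 :=
    (norm_mellin_fractIoi_le h0).trans (by rw [div_le_iff₀ h0]; linarith)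
  have ha := abs_nonneg s.im
  rw [regZeta_eq h0]
  calc _ ≤ ‖s‖ + ‖s‖ * ‖s - 1‖ * ‖mellin fractIoi (-s)‖ := by
        rw [← norm_mul, ← norm_mul]; exact norm_sub_le _ _
    _ ≤ 4 * (1 + |s.im|) + (4 * (1 + |s.im|)) * (4 * (1 + |s.im|)) * 2 := by gcongr
    _ ≤ 36 * (1 + |s.im|) ^ 2 := by nlinarith

lemma exists_le_norm_regZeta : ∃ c : ℝ, 0 < c ∧ ∀ t : ℝ, c ≤ ‖regZeta (2 + t * I)‖ := by
  have hsum : Summable (fun n : ℕ ↦ 1 / (n : ℝ) ^ (2 : ℝ)) :=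
    Real.summable_one_div_nat_rpow.mpr (by norm_num)
  set M := ∑' n : ℕ, 1 / (n : ℝ) ^ (2 : ℝ) with hM
  have hMpos : 0 ≤ M := tsum_nonneg fun n ↦ by positivity
  refine ⟨1 / (M + 1), by positivity, fun t ↦ ?_⟩
  have hre : (2 + t * I : ℂ).re = 2 := by simp
  have h1 : 1 < (2 + t * I : ℂ).re := by rw [hre]; norm_num
  have hne : (2 + t * I : ℂ) ≠ 1 := fun h ↦ by rw [h] at h1; simp at h1
  have hmul := ArithmeticFunction.LSeries_zeta_mul_Lseries_moebius h1
  rw [ArithmeticFunction.LSeries_zeta_eq_riemannZeta h1] at hmul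
  have hle : ‖LSeries (fun n ↦ ((ArithmeticFunction.moebius n : ℤ) : ℂ)) (2 + t * I)‖ ≤ M := by
    refine tsum_of_norm_bounded hsum.hasSum fun n ↦ ?_
    refine (LSeries.norm_term_le_of_re_le_re _ (s := 2) (by simp) n).trans ?_
    rw [LSeries.norm_term_eq]
    split_ifs with hn
    · simp [hn]
    · simp only [re_ofNat]
      gcongr
      rw [norm_intCast]
      exact_mod_cast ArithmeticFunction.abs_moebius_le_one
  have hz : 1 ≤ ‖riemannZeta (2 + t * I)‖ * (M + 1) := by
    have := congrArg norm hmul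
    rw [norm_mul, norm_one] at this
    rw [← this]
    gcongr
    linarith
  have hs1 : 1 ≤ ‖(2 + t * I : ℂ) - 1‖ := by
    refine le_trans ?_ (abs_re_le_norm _)
    simp [hre]
    norm_num
  rw [regZeta_of_ne_one hne, norm_mul, div_le_iff₀ (by positivity), mul_assoc]
  nlinarith

lemma regZeta_ne_zero (hRH : ∀ s : ℂ, riemannZeta s = 0 → 0 < s.re → s.re < 1 → s.re = 1 / 2)
    {s : ℂ} (hs : 1 / 2 < s.re) : regZeta s ≠ 0 := by
  by_cases h1 : s = 1
  · rw [h1, regZeta_one]; exact one_ne_zero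
  rw [regZeta_of_ne_one h1]
  refine mul_ne_zero (sub_ne_zero.mpr h1) fun h0 ↦ ?_
  rcases lt_or_ge s.re 1 with h | h
  · exact absurd (hRH s h0 (by linarith) h) hs.ne'
  · exact riemannZeta_ne_zero_of_one_le_re h h0

lemma exists_log_of_ball {f : ℂ → ℂ} {c : ℂ} {R : ℝ} (hR : 0 < R) (hf : Differentiable ℂ f)
    (h0 : ∀ z ∈ Metric.ball c R, f z ≠ 0) :
    ∃ g : ℂ → ℂ, g c = 0 ∧ (∀ z ∈ Metric.ball c R, HasDerivAt g (deriv f z / f z) z) ∧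
      ∀ z ∈ Metric.ball c R, f z = f c * exp (g z) := by
  have hd : DifferentiableOn ℂ (fun z ↦ deriv f z / f z) (Metric.ball c R) :=
    (hf.differentiableOn.deriv isOpen_univ |>.mono (subset_univ _)).div
      hf.differentiableOn h0
  obtain ⟨g, hgc, hg⟩ := hd.isExactOn_ball.with_val_at c 0
  refine ⟨g, hgc, hg, fun z hz ↦ ?_⟩
  have hc : c ∈ Metric.ball c R := Metric.mem_ball_self hR
  have hconst : ∀ w ∈ Metric.ball c R, HasDerivAt (fun w ↦ f w * exp (-g w)) 0 w := by
    intro w hw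
    have h1 : HasDerivAt (fun w ↦ f w * exp (-g w))
        (deriv f w * exp (-g w) + f w * (exp (-g w) * -(deriv f w / f w))) w :=
      (hf w).hasDerivAt.mul (hg w hw).neg.cexp
    have h2 : deriv f w * exp (-g w) + f w * (exp (-g w) * -(deriv f w / f w)) = 0 := by
      have := h0 w hw
      field_simp
      ring
    rwa [h2] at h1
  have heq := Metric.isOpen_ball.is_const_of_deriv_eq_zero (𝕜 := ℂ)
    (convex_ball c R).isPreconnected
    (fun w hw ↦ (hconst w hw).differentiableAt.differentiableWithinAt)
    (fun w hw ↦ (hconst w hw).deriv) hz hc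
  simp only [hgc, neg_zero, exp_zero, mul_one] at heq
  rw [← heq, mul_assoc, ← exp_add, neg_add_cancel, exp_zero, mul_one]

lemma norm_logDeriv_le_of_ball {f : ℂ → ℂ} {c : ℂ} {M : ℝ} (hM : 0 < M)
    (hf : Differentiable ℂ f) (h0 : ∀ z ∈ Metric.ball c (3 / 2), f z ≠ 0)
    (hb : ∀ z ∈ Metric.ball c (3 / 2), ‖f z‖ ≤ Real.exp M * ‖f c‖) {w : ℂ}
    (hw : ‖w - c‖ ≤ 7 / 5) : ‖deriv f w / f w‖ ≤ 5000 * M := by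
  obtain ⟨g, hgc, hg, hfg⟩ := exists_log_of_ball (by norm_num) hf h0
  have hfc : f c ≠ 0 := h0 c (Metric.mem_ball_self (by norm_num))
  have hre : ∀ z ∈ Metric.ball c (3 / 2), (g z).re ≤ M := by
    intro z hz
    have h1 := hb z hz
    rw [hfg z hz, norm_mul, norm_exp, mul_comm] at h1
    exact Real.exp_le_exp.mp (le_of_mul_le_mul_right h1 (norm_pos_iff.mpr hfc))
  have hgb : ∀ z : ℂ, ‖z - c‖ ≤ 71 / 50 → ‖g z‖ ≤ 100 * M := by
    intro z hz
    have hmem : ∀ y ∈ Metric.ball (0 : ℂ) (3 / 2), y + c ∈ Metric.ball c (3 / 2) := by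
      intro y hy
      simpa [Metric.mem_ball, dist_eq_norm] using hy
    have hzb : z - c ∈ Metric.ball (0 : ℂ) (3 / 2) := by
      rw [mem_ball_zero_iff]; linarith
    have h1 := borelCaratheodory_zero (f := fun y ↦ g (y + c)) (R := 3 / 2) hM
      (fun y hy ↦ ((hg _ (hmem y hy)).differentiableAt.comp y
        (by fun_prop)).differentiableWithinAt)
      (fun y hy ↦ hre _ (hmem y hy)) (by norm_num) hzb (by simpa using hgc)
    simp only [sub_add_cancel] at h1
    refine h1.trans ?_
    rw [div_le_iff₀ (by linarith)]
    nlinarith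
  have hball : ∀ z : ℂ, ‖z - w‖ ≤ 1 / 50 → ‖z - c‖ ≤ 71 / 50 := by
    intro z hz
    calc ‖z - c‖ = ‖(z - w) + (w - c)‖ := by ring_nf
      _ ≤ ‖z - w‖ + ‖w - c‖ := norm_add_le _ _
      _ ≤ 71 / 50 := by linarith
  have hsub : ∀ z : ℂ, ‖z - w‖ ≤ 1 / 50 → z ∈ Metric.ball c (3 / 2) := by
    intro z hz
    rw [Metric.mem_ball, dist_eq_norm]
    linarith [hball z hz]
  have hdiff : DiffContOnCl ℂ g (Metric.ball w (1 / 50)) := by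
    refine DifferentiableOn.diffContOnCl fun z hz ↦ ?_
    have hz' := Metric.closure_ball_subset_closedBall hz
    rw [Metric.mem_closedBall, dist_eq_norm] at hz'
    exact (hg z (hsub z hz')).differentiableAt.differentiableWithinAt
  have h2 := norm_deriv_le_of_forall_mem_sphere_norm_le (by norm_num) hdiff
    (C := 100 * M) fun z hz ↦ by
      rw [Metric.mem_sphere, dist_eq_norm] at hz
      exact hgb z (hball z hz.le)
  rw [(hg w (hsub w (by simp))).deriv] at h2
  linarith

/-- Under the Riemann hypothesis the logarithmic derivative of `(s - 1) ζ(s)` grows more slowly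
than any power of the height in `Re s ≥ 3/5`. -/
lemma exists_norm_logDeriv_regZeta_le
    (hRH : ∀ s : ℂ, riemannZeta s = 0 → 0 < s.re → s.re < 1 → s.re = 1 / 2) :
    ∃ A : ℝ, 0 < A ∧ ∀ s : ℂ, 3 / 5 ≤ s.re → s.re ≤ 2 →
      ‖deriv regZeta s / regZeta s‖ ≤ A * (1 + |s.im|) ^ (1 / 20 : ℝ) := by
  obtain ⟨c₀, hc₀, hlow⟩ := exists_le_norm_regZeta
  set K : ℝ := 1 + Real.log (1 + 36 * 9 / c₀) with hK
  have hKpos : 0 < K := by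
    have : 0 ≤ Real.log (1 + 36 * 9 / c₀) := Real.log_nonneg (by
      have : 0 < 36 * 9 / c₀ := by positivity
      linarith)
    linarith
  refine ⟨5000 * (K + 40), by positivity, fun s hs hs2 ↦ ?_⟩
  set T : ℝ := 1 + |s.im| with hT
  have hT1 : 1 ≤ T := by linarith [abs_nonneg s.im]
  have hT0 : 0 < T := by linarith
  have hlogT : Real.log T ≤ 20 * T ^ (1 / 20 : ℝ) := by
    have := Real.log_le_rpow_div hT0.le (by norm_num : (0 : ℝ) < 1 / 20)
    linarith
  have hlogT0 : 0 ≤ Real.log T := Real.log_nonneg hT1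
  have hTp : 1 ≤ T ^ (1 / 20 : ℝ) := Real.one_le_rpow hT1 (by norm_num)
  have key := norm_logDeriv_le_of_ball (f := regZeta) (c := 2 + s.im * I) (w := s)
    (M := K + 2 * Real.log T) (by positivity) differentiable_regZeta ?_ ?_ ?_
  · refine key.trans ?_
    rw [mul_assoc]
    gcongr
    nlinarith
  · intro z hz
    rw [Metric.mem_ball, dist_eq_norm] at hz
    have := (abs_re_le_norm _).trans_lt hz
    rw [abs_lt] at this
    simp at this
    exact regZeta_ne_zero hRH (by linarith)
  · intro z hz
    rw [Metric.mem_ball, dist_eq_norm] at hz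
    have h1 := (abs_re_le_norm _).trans_lt hz
    have h2 := (abs_im_le_norm _).trans_lt hz
    rw [abs_lt] at h1
    simp at h1 h2
    have him : |z.im| ≤ |s.im| + 3 / 2 := by
      have := abs_sub_abs_le_abs_sub z.im s.im
      linarith
    have hb := norm_regZeta_le (s := z) (by linarith) (by linarith)
    have h3 : (1 + |z.im|) ^ 2 ≤ 9 * T ^ 2 := by
      have : 1 + |z.im| ≤ 3 * T := by rw [hT]; linarith [abs_nonneg s.im]
      have h0 := abs_nonneg z.im
      nlinarith
    have hexp : Real.exp (K + 2 * Real.log T) =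
        Real.exp 1 * (1 + 36 * 9 / c₀) * T ^ 2 := by
      rw [hK, Real.exp_add, Real.exp_add, Real.exp_log (by positivity), mul_comm 2 (Real.log T),
        Real.exp_mul, Real.exp_log hT0]
      norm_num
    have he : 1 ≤ Real.exp 1 := Real.one_le_exp (by norm_num)
    calc ‖regZeta z‖ ≤ 36 * (9 * T ^ 2) := by linarith
      _ = (36 * 9 / c₀) * T ^ 2 * c₀ := by field_simp
      _ ≤ (Real.exp 1 * (1 + 36 * 9 / c₀)) * T ^ 2 * c₀ := by
        gcongr
        have : 0 < 36 * 9 / c₀ := by positivity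
        nlinarith
      _ ≤ _ := by
        rw [hexp]
        gcongr
        exact hlow s.im
  · have : s - (2 + s.im * I) = ((s.re - 2 : ℝ) : ℂ) := by
      apply Complex.ext <;> simp
    rw [this, norm_real, Real.norm_eq_abs, abs_le]
    constructor <;> linarith

lemma integrable_of_norm_le_rpow {E : Type*} [NormedAddCommGroup E] {f : ℝ → E}
    (hf : Continuous f) {C q : ℝ} (hq : 1 < q) (hb : ∀ y, ‖f y‖ ≤ C * (1 + |y|) ^ (-q)) :
    Integrable f := by
  refine Integrable.mono' (g := fun y : ℝ ↦ C * (1 + ‖y‖) ^ (-q))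
    ((integrable_one_add_norm (by simpa using hq)).const_mul C) hf.aestronglyMeasurable ?_
  exact ae_of_all _ fun y ↦ by simpa using hb y

lemma one_add_abs_im_le {w : ℂ} (hw : 3 / 5 ≤ w.re) : (1 + |w.im|) / 4 ≤ ‖w‖ := by
  have h1 := Complex.abs_im_le_norm w
  have h2 := Complex.re_le_norm w
  linarith

/-- Mellin inversion on the line `Re s = -3`, in terms of the variable `w = -1 - s`. -/
lemma eq_integral_of_mellin_eq {k : ℝ → ℂ} {G : ℂ → ℂ} (hconv : MellinConvergent k (-3))
    (hG : ∀ y : ℝ, mellin k (-3 + y * I) = G (2 - y * I))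
    (hInt : Integrable fun y : ℝ ↦ G (2 + y * I)) (hk : Continuous k) {x : ℝ} (hx : 0 < x) :
    k x = (1 / (2 * Real.pi)) • ∫ y : ℝ, (x : ℂ) ^ (3 + y * I) * G (2 + y * I) := by
  have h := mellinInv_mellin_eq (-3) k hx (by simpa using hconv) (by
    have := hInt.comp_neg
    refine this.congr (ae_of_all _ fun y ↦ ?_)
    have := hG y
    push_cast at this ⊢
    rw [this]; ring_nf) hk.continuousAt
  rw [← h, mellinInv, ← integral_neg_eq_self]
  congr 2
  ext y
  have := hG (-y)
  push_cast at this ⊢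
  rw [this, smul_eq_mul]
  ring_nf

lemma norm_inv_mul_add_one_le {w : ℂ} (hw : 3 / 5 ≤ w.re) :
    ‖(w * (w + 1))⁻¹‖ ≤ 16 * (1 + |w.im|) ^ (-2 : ℝ) := by
  have h1 := one_add_abs_im_le hw
  have h2 := one_add_abs_im_le (w := w + 1) (by simp; linarith)
  simp only [add_im, one_im, add_zero] at h2
  have h3 : 0 < 1 + |w.im| := by positivity
  rw [norm_inv, norm_mul, Real.rpow_neg h3.le, Real.rpow_two, inv_le_iff_one_le_mul₀ (by nlinarith)]
  have : (1 + |w.im|) / 4 * ((1 + |w.im|) / 4) ≤ ‖w‖ * ‖w + 1‖ := by gcongr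
  calc (1 : ℝ) = 16 * ((1 + |w.im|) ^ 2)⁻¹ * ((1 + |w.im|) / 4 * ((1 + |w.im|) / 4)) := by
        field_simp; norm_num
    _ ≤ _ := by gcongr

lemma mellin_kernel {s : ℂ} (hs : s.re < -1) :
    MellinConvergent ((Ioi 1).indicator fun t : ℝ ↦ (t : ℂ) - 1) s ∧
    mellin ((Ioi 1).indicator fun t : ℝ ↦ (t : ℂ) - 1) s = (s * (s + 1))⁻¹ := by
  have hs0 : s ≠ 0 := by rintro rfl; norm_num at hs
  have hs1 : s + 1 ≠ 0 := fun h ↦ by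
    have := congrArg Complex.re h
    simp at this; linarith
  have h1 := integrableOn_Ioi_cpow_of_lt (a := s) hs one_pos
  have h2 := integrableOn_Ioi_cpow_of_lt (a := s - 1) (by simp; linarith) one_pos
  have heq : EqOn (fun t : ℝ ↦ (t : ℂ) ^ (s - 1) * ((t : ℂ) - 1))
      (fun t : ℝ ↦ (t : ℂ) ^ s - (t : ℂ) ^ (s - 1)) (Ioi 1) := by
    intro t ht
    have ht0 : (t : ℂ) ≠ 0 := by exact_mod_cast (one_pos.trans ht).ne'
    simp only [cpow_sub _ _ ht0, cpow_one]
    field_simp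
  constructor
  · rw [mellinConvergent_indicator_Ioi_one, integrableOn_congr_fun heq measurableSet_Ioi]
    exact h1.sub h2
  · rw [mellin_indicator_Ioi_one, setIntegral_congr_fun measurableSet_Ioi heq,
      integral_sub h1 h2, integral_Ioi_cpow_of_lt hs one_pos,
      integral_Ioi_cpow_of_lt (by simp; linarith) one_pos]
    simp only [ofReal_one, one_cpow, sub_add_cancel]
    field_simp
    ring

lemma mellin_kernel_sq {s : ℂ} (hs : s.re < -2) :
    MellinConvergent ((Ioi 1).indicator fun t : ℝ ↦ ((t : ℂ) - 1) ^ 2 / 2) s ∧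
    mellin ((Ioi 1).indicator fun t : ℝ ↦ ((t : ℂ) - 1) ^ 2 / 2) s =
      -(s * (s + 1) * (s + 2))⁻¹ := by
  have hs0 : s ≠ 0 := by rintro rfl; norm_num at hs
  have hs1 : s + 1 ≠ 0 := fun h ↦ by
    have := congrArg Complex.re h
    simp at this; linarith
  have hs2 : s + 2 ≠ 0 := fun h ↦ by
    have := congrArg Complex.re h
    simp at this; linarith
  have h0 := integrableOn_Ioi_cpow_of_lt (a := s + 1) (by simp; linarith) one_pos
  have h1 := integrableOn_Ioi_cpow_of_lt (a := s) (by linarith) one_pos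
  have h2 := integrableOn_Ioi_cpow_of_lt (a := s - 1) (by simp; linarith) one_pos
  have heq : EqOn (fun t : ℝ ↦ (t : ℂ) ^ (s - 1) * (((t : ℂ) - 1) ^ 2 / 2))
      (fun t : ℝ ↦ ((t : ℂ) ^ (s + 1) / 2 - (t : ℂ) ^ s) + (t : ℂ) ^ (s - 1) / 2) (Ioi 1) := by
    intro t ht
    have ht0 : (t : ℂ) ≠ 0 := by exact_mod_cast (one_pos.trans ht).ne'
    simp only [cpow_sub _ _ ht0, cpow_add _ _ ht0, cpow_one]
    field_simp
    ring
  have h01 : IntegrableOn (fun t : ℝ ↦ (t : ℂ) ^ (s + 1) / 2 - (t : ℂ) ^ s) (Ioi 1) :=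
    (h0.div_const 2).sub h1
  constructor
  · rw [mellinConvergent_indicator_Ioi_one, integrableOn_congr_fun heq measurableSet_Ioi]
    exact h01.add (h2.div_const 2)
  · rw [mellin_indicator_Ioi_one, setIntegral_congr_fun measurableSet_Ioi heq,
      integral_add h01 (h2.div_const 2),
      integral_sub (h0.div_const 2) h1, integral_div, integral_div,
      integral_Ioi_cpow_of_lt (a := s + 1) (by simp; linarith) one_pos,
      integral_Ioi_cpow_of_lt (a := s) (by linarith) one_pos,
      integral_Ioi_cpow_of_lt (a := s - 1) (by simp; linarith) one_pos]
    have hs3 : s + 1 + 1 ≠ 0 := by rwa [add_assoc, one_add_one_eq_two]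
    simp only [ofReal_one, one_cpow, sub_add_cancel]
    field_simp
    ring

lemma norm_inv_line_le (y : ℝ) :
    ‖((2 + y * I : ℂ) * (2 + y * I + 1))⁻¹‖ ≤ 16 * (1 + |y|) ^ (-2 : ℝ) := by
  simpa using norm_inv_mul_add_one_le (w := 2 + y * I) (by norm_num)

lemma line_ne_zero (c : ℝ) (hc : c ≠ 0) (y : ℝ) : (c + y * I : ℂ) ≠ 0 := fun h ↦ by
  have := congrArg Complex.re h
  simp at this; exact hc this

lemma integrable_inv_line : Integrable fun y : ℝ ↦ ((2 + y * I : ℂ) * (2 + y * I + 1))⁻¹ := by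
  refine integrable_of_norm_le_rpow ?_ (by norm_num : (1 : ℝ) < 2) norm_inv_line_le
  refine Continuous.inv₀ (by fun_prop) fun y ↦ mul_ne_zero ?_ ?_
  · simpa using line_ne_zero 2 (by norm_num) y
  · have := line_ne_zero 3 (by norm_num) y
    convert this using 1; push_cast; ring

lemma integrable_inv_line_sq :
    Integrable fun y : ℝ ↦ ((2 + y * I - 1 : ℂ) * ((2 + y * I) * (2 + y * I + 1)))⁻¹ := by
  have h1 : ∀ y : ℝ, (2 + y * I - 1 : ℂ) ≠ 0 := fun y ↦ by
    have := line_ne_zero 1 (by norm_num) y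
    convert this using 1; push_cast; ring
  refine integrable_of_norm_le_rpow ?_ (by norm_num : (1 : ℝ) < 2) (C := 16) fun y ↦ ?_
  · refine Continuous.inv₀ (by fun_prop) fun y ↦ mul_ne_zero (h1 y) (mul_ne_zero ?_ ?_)
    · simpa using line_ne_zero 2 (by norm_num) y
    · have := line_ne_zero 3 (by norm_num) y
      convert this using 1; push_cast; ring
  · rw [mul_inv, norm_mul]
    refine (mul_le_of_le_one_left (norm_nonneg _) ?_).trans (norm_inv_line_le y)
    rw [norm_inv]
    refine inv_le_one_of_one_le₀ ?_
    have := Complex.re_le_norm (2 + y * I - 1 : ℂ)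
    norm_num at this
    exact this

lemma continuous_indicator_Ioi_one {f : ℝ → ℂ} (hf : Continuous f) (h1 : f 1 = 0) :
    Continuous ((Ioi (1 : ℝ)).indicator f) :=
  hf.indicator fun a ha ↦ by
    rw [frontier_Ioi, mem_singleton_iff] at ha
    rw [ha, h1]

lemma max_sub_one_eq_integral {t : ℝ} (ht : 0 < t) :
    ((max (t - 1) 0 : ℝ) : ℂ) = (1 / (2 * Real.pi)) • ∫ y : ℝ, (t : ℂ) ^ (3 + y * I : ℂ) *
      ((2 + y * I : ℂ) * (2 + y * I + 1))⁻¹ := by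
  have h := eq_integral_of_mellin_eq (k := (Ioi 1).indicator fun t : ℝ ↦ (t : ℂ) - 1)
    (G := fun w ↦ (w * (w + 1))⁻¹) (mellin_kernel (by norm_num)).1
    (fun y ↦ by
      rw [(mellin_kernel (by norm_num)).2]
      congr 1; ring) integrable_inv_line
    (continuous_indicator_Ioi_one (by fun_prop) (by simp)) ht
  rw [← h, indicator_apply]
  split_ifs with h1
  · rw [max_eq_left (by simpa using le_of_lt h1)]; push_cast; rfl
  · rw [max_eq_right (by simpa using h1)]; rfl

lemma max_sub_one_sq_eq_integral {t : ℝ} (ht : 0 < t) :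
    ((max (t - 1) 0 ^ 2 / 2 : ℝ) : ℂ) =
      (1 / (2 * Real.pi)) • ∫ y : ℝ, (t : ℂ) ^ (3 + y * I : ℂ) *
        ((2 + y * I - 1 : ℂ) * ((2 + y * I) * (2 + y * I + 1)))⁻¹ := by
  have h := eq_integral_of_mellin_eq (k := (Ioi 1).indicator fun t : ℝ ↦ ((t : ℂ) - 1) ^ 2 / 2)
    (G := fun w ↦ ((w - 1) * (w * (w + 1)))⁻¹) (mellin_kernel_sq (by norm_num)).1
    (fun y ↦ by
      rw [(mellin_kernel_sq (by norm_num)).2, ← inv_neg]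
      congr 1; ring) integrable_inv_line_sq
    (continuous_indicator_Ioi_one (by fun_prop) (by simp)) ht
  rw [← h, indicator_apply]
  split_ifs with h1
  · rw [max_eq_left (by simpa using le_of_lt h1)]; push_cast; rfl
  · rw [max_eq_right (by simpa using h1)]; simp

/-- The Cesàro-type smoothing `∑ Λ(n) max (x - n) 0` of the Chebyshev function `ψ`. -/
noncomputable def smoothedPsi (x : ℝ) : ℝ :=
  ∑' n : ℕ, ArithmeticFunction.vonMangoldt n * max (x - n) 0

lemma summable_smoothedPsi (x : ℝ) :
    Summable fun n : ℕ ↦ ArithmeticFunction.vonMangoldt n * max (x - n) 0 := by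
  refine summable_of_ne_finset_zero (s := Finset.range (⌈x⌉₊)) fun n hn ↦ ?_
  rw [Finset.mem_range, not_lt, Nat.ceil_le] at hn
  rw [max_eq_right (by linarith), mul_zero]

lemma integrable_cpow_line_mul {x : ℝ} (hx : 0 < x) {f : ℝ → ℂ} (hf : Integrable f) :
    Integrable fun y : ℝ ↦ (x : ℂ) ^ (3 + y * I : ℂ) * f y := by
  have hx0 : (x : ℂ) ≠ 0 := by exact_mod_cast hx.ne'
  refine hf.bdd_mul (c := x ^ (3 : ℝ)) (Continuous.aestronglyMeasurable ?_)
    (ae_of_all _ fun y ↦ ?_)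
  · exact Continuous.const_cpow (by fun_prop) (Or.inl hx0)
  · rw [norm_cpow_eq_rpow_re_of_pos hx]
    simp

lemma continuous_logDeriv_regZeta_line {σ : ℝ} (h : ∀ y : ℝ, regZeta (σ + y * I) ≠ 0) :
    Continuous fun y : ℝ ↦ deriv regZeta (σ + y * I) / regZeta (σ + y * I) := by
  have h1 : Continuous (deriv regZeta) :=
    (differentiable_regZeta.contDiff (n := 1)).continuous_deriv le_rfl
  exact (h1.comp (by fun_prop)).div (differentiable_regZeta.continuous.comp (by fun_prop)) h

lemma neg_deriv_riemannZeta_div {w : ℂ} (hw : 1 < w.re) :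
    -deriv riemannZeta w / riemannZeta w = (w - 1)⁻¹ - deriv regZeta w / regZeta w := by
  have hw1 : w ≠ 1 := by rintro rfl; simp at hw
  have hz := riemannZeta_ne_zero_of_one_le_re hw.le
  have hd : HasDerivAt (fun s ↦ (s - 1) * riemannZeta s)
      (1 * riemannZeta w + (w - 1) * deriv riemannZeta w) w :=
    ((hasDerivAt_id w).sub_const 1).mul (differentiableAt_riemannZeta hw1).hasDerivAt
  have heq : regZeta =ᶠ[𝓝 w] fun s ↦ (s - 1) * riemannZeta s := by
    filter_upwards [isOpen_ne.mem_nhds hw1] with s hs using regZeta_of_ne_one hs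
  have h1 : w - 1 ≠ 0 := sub_ne_zero.mpr hw1
  rw [heq.deriv_eq, hd.deriv, regZeta_of_ne_one hw1]
  field_simp
  ring

lemma vonMangoldt_mul_max_eq_integral {x : ℝ} (hx : 0 < x) (n : ℕ) :
    ((ArithmeticFunction.vonMangoldt n * max (x - n) 0 : ℝ) : ℂ) =
      (1 / (2 * Real.pi)) • ∫ y : ℝ, (x : ℂ) ^ (3 + y * I : ℂ) *
        (((2 + y * I : ℂ) * (2 + y * I + 1))⁻¹ *
          LSeries.term (fun n ↦ (ArithmeticFunction.vonMangoldt n : ℂ)) (2 + y * I) n) := by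
  rcases eq_or_ne n 0 with rfl | hn
  · simp
  have hn0 : (0 : ℝ) < n := by positivity
  have hnc : (n : ℂ) ≠ 0 := by exact_mod_cast hn
  have h1 : max (x - n) 0 = n * max (x / n - 1) 0 := by
    rw [mul_max_of_nonneg _ _ hn0.le, mul_zero, mul_sub, mul_one, mul_div_cancel₀ _ hn0.ne']
  rw [h1]
  rw [ofReal_mul, ofReal_mul, max_sub_one_eq_integral (div_pos hx hn0), mul_smul_comm, mul_smul_comm,
    ← integral_const_mul, ← integral_const_mul]
  congr 2
  ext y
  rw [LSeries.term_of_ne_zero hn, ofReal_div, div_cpow_ofReal_nonneg hx.le hn0.le]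
  have h2 : (n : ℂ) ^ (3 + y * I : ℂ) = n * (n : ℂ) ^ (2 + y * I : ℂ) := by
    rw [show (3 + y * I : ℂ) = 1 + (2 + y * I) by ring, cpow_add _ _ hnc, cpow_one]
  have h3 : (n : ℂ) ^ (2 + y * I : ℂ) ≠ 0 := by simp [cpow_eq_zero_iff, hnc]
  rw [ofReal_natCast, h2]
  generalize ((2 + y * I : ℂ) * (2 + y * I + 1))⁻¹ = A
  field_simp

lemma smoothedPsi_eq_integral {x : ℝ} (hx : 0 < x) :
    ((smoothedPsi x : ℝ) : ℂ) = (1 / (2 * Real.pi)) • ∫ y : ℝ, (x : ℂ) ^ (3 + y * I : ℂ) *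
      (((2 + y * I : ℂ) * (2 + y * I + 1))⁻¹ *
        ((2 + y * I - 1 : ℂ)⁻¹ -
          deriv regZeta (2 + y * I) / regZeta (2 + y * I))) := by
  set Λ' : ℕ → ℂ := fun n ↦ (ArithmeticFunction.vonMangoldt n : ℂ) with hΛ
  set f : ℕ → ℝ → ℂ := fun n y ↦ (x : ℂ) ^ (3 + y * I : ℂ) *
    (((2 + y * I : ℂ) * (2 + y * I + 1))⁻¹ * LSeries.term Λ' (2 + y * I) n) with hf
  have hcont : ∀ n, Continuous fun y : ℝ ↦ LSeries.term Λ' (2 + y * I) n := by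
    intro n
    rcases eq_or_ne n 0 with rfl | hn
    · simpa using continuous_const
    have hnc : (n : ℂ) ≠ 0 := by exact_mod_cast hn
    simp only [LSeries.term_of_ne_zero hn]
    exact continuous_const.div (Continuous.const_cpow (by fun_prop) (Or.inl hnc))
      fun y ↦ by simp [cpow_eq_zero_iff, hnc]
  have hnorm : ∀ n (y : ℝ), ‖LSeries.term Λ' (2 + y * I) n‖ = ‖LSeries.term Λ' 2 n‖ := by
    intro n y
    rw [LSeries.norm_term_eq, LSeries.norm_term_eq]
    simp
  have hInt : ∀ n, Integrable (f n) := by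
    intro n
    refine integrable_cpow_line_mul hx ?_
    exact integrable_inv_line.mul_bdd (c := ‖LSeries.term Λ' 2 n‖) (hcont n).aestronglyMeasurable
      (ae_of_all _ fun y ↦ (hnorm n y).le)
  have hsum : Summable fun n ↦ ∫ y, ‖f n y‖ := by
    have h2 : Summable fun n ↦ ‖LSeries.term Λ' 2 n‖ :=
      (ArithmeticFunction.LSeriesSummable_vonMangoldt (s := 2) (by norm_num)).norm
    refine (h2.mul_left (∫ y : ℝ, ‖(x : ℂ) ^ (3 + y * I : ℂ)
      * ((2 + y * I : ℂ) * (2 + y * I + 1))⁻¹‖)).congr fun n ↦ ?_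
    rw [← integral_mul_const]
    congr 1
    ext y
    rw [hf]
    simp only [norm_mul, hnorm, mul_assoc]
  have h1 := (hasSum_integral_of_summable_integral_norm hInt hsum).const_smul
    (1 / (2 * Real.pi))
  have h2 : HasSum (fun n : ℕ ↦ ((ArithmeticFunction.vonMangoldt n * max (x - n) 0 : ℝ) : ℂ))
      ((smoothedPsi x : ℝ) : ℂ) := Complex.hasSum_ofReal.mpr (summable_smoothedPsi x).hasSum
  simp_rw [vonMangoldt_mul_max_eq_integral hx] at h2
  rw [h2.unique h1]
  congr 2
  ext y
  rw [hf]
  simp only [tsum_mul_left]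
  congr 2
  have hw : 1 < (2 + y * I : ℂ).re := by simp
  rw [← neg_deriv_riemannZeta_div hw,
    ← ArithmeticFunction.LSeries_vonMangoldt_eq_deriv_riemannZeta_div hw]
  rfl

lemma smoothedPsi_sub_eq_integral
    (hRH : ∀ s : ℂ, riemannZeta s = 0 → 0 < s.re → s.re < 1 → s.re = 1 / 2)
    {x : ℝ} (hx : 0 < x) :
    ((smoothedPsi x - max (x - 1) 0 ^ 2 / 2 : ℝ) : ℂ) =
      -((1 / (2 * Real.pi)) • ∫ y : ℝ, (x : ℂ) ^ (3 + y * I : ℂ) *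
        (((2 + y * I : ℂ) * (2 + y * I + 1))⁻¹ *
          (deriv regZeta (2 + y * I) / regZeta (2 + y * I)))) := by
  obtain ⟨A, hA, hb⟩ := exists_norm_logDeriv_regZeta_le hRH
  have hI : Integrable fun y : ℝ ↦ ((2 + y * I : ℂ) * (2 + y * I + 1))⁻¹ *
          (deriv regZeta (2 + y * I) / regZeta (2 + y * I)) := by
    refine integrable_of_norm_le_rpow (C := 16 * A) (q := 39 / 20) ?_ (by norm_num) fun y ↦ ?_
    · refine Continuous.mul ?_ ?_
      · refine Continuous.inv₀ (by fun_prop) fun y ↦ mul_ne_zero ?_ ?_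
        · simpa using line_ne_zero 2 (by norm_num) y
        · have := line_ne_zero 3 (by norm_num) y
          convert this using 1; push_cast; ring
      · exact_mod_cast continuous_logDeriv_regZeta_line (σ := 2) fun y ↦
          regZeta_ne_zero hRH (by norm_num)
    · rw [norm_mul]
      have h1 := norm_inv_line_le y
      have h2 := hb (2 + y * I) (by norm_num) (by simp)
      simp only [add_im, im_ofNat, mul_im, ofReal_re, I_im, mul_one, ofReal_im, I_re, mul_zero,
        add_zero, zero_add] at h2
      calc _ ≤ (16 * (1 + |y|) ^ (-2 : ℝ)) * (A * (1 + |y|) ^ (1 / 20 : ℝ)) := by gcongr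
        _ = 16 * A * ((1 + |y|) ^ (-2 : ℝ) * (1 + |y|) ^ (1 / 20 : ℝ)) := by ring
        _ = _ := by
          rw [← Real.rpow_add (by positivity)]
          norm_num
  rw [ofReal_sub, smoothedPsi_eq_integral hx, max_sub_one_sq_eq_integral hx, ← smul_sub,
    ← smul_neg, ← integral_sub _ (integrable_cpow_line_mul hx integrable_inv_line_sq),
    ← integral_neg]
  · congr 2
    ext y
    rw [mul_inv ((2 + y * I - 1 : ℂ))]
    ring
  · refine integrable_cpow_line_mul hx ((integrable_inv_line_sq.sub hI).congr
      (ae_of_all _ fun y ↦ ?_))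
    simp only [Pi.sub_apply]
    rw [mul_inv ((2 + y * I - 1 : ℂ))]
    ring

lemma integral_vertical_eq_of_norm_le {f : ℂ → ℂ} {a b M q : ℝ} (hab : a ≤ b) (hq : 1 < q)
    (hd : ∀ z : ℂ, a ≤ z.re → z.re ≤ b → DifferentiableAt ℂ f z)
    (hb : ∀ z : ℂ, a ≤ z.re → z.re ≤ b → ‖f z‖ ≤ M * (1 + |z.im|) ^ (-q)) :
    ∫ y : ℝ, f (a + y * I) = ∫ y : ℝ, f (b + y * I) := by
  have hInt : ∀ u : ℝ, a ≤ u → u ≤ b → Integrable fun y : ℝ ↦ f (u + y * I) := by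
    intro u h1 h2
    refine integrable_of_norm_le_rpow (C := M) ?_ hq fun y ↦ ?_
    · rw [continuous_iff_continuousAt]
      intro y
      exact ContinuousAt.comp (f := fun y : ℝ ↦ (u + y * I : ℂ)) (g := f)
        (hd _ (by simpa using h1) (by simpa using h2)).continuousAt
        (by fun_prop)
    · simpa using hb (u + y * I) (by simpa using h1) (by simpa using h2)
  have hlim : ∀ u : ℝ, a ≤ u → u ≤ b →
      Tendsto (fun T : ℝ ↦ ∫ y in (-T)..T, f (u + y * I)) atTop (𝓝 (∫ y : ℝ, f (u + y * I))) :=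
    fun u h1 h2 ↦ intervalIntegral_tendsto_integral (hInt u h1 h2)
      tendsto_neg_atTop_atBot tendsto_id
  have hhor : ∀ T : ℝ, ‖∫ t in a..b, f (t + T * I)‖ ≤ M * (1 + |T|) ^ (-q) * |b - a| := by
    intro T
    refine intervalIntegral.norm_integral_le_of_norm_le_const fun t ht ↦ ?_
    rw [uIoc_of_le hab] at ht
    simpa using hb (t + T * I) (by simpa using ht.1.le) (by simpa using ht.2)
  have hzero : Tendsto (fun T : ℝ ↦ M * (1 + |T|) ^ (-q) * |b - a|) atTop (𝓝 0) := by
    have h1 : Tendsto (fun T : ℝ ↦ (1 + |T|) ^ (-q)) atTop (𝓝 0) :=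
      (tendsto_rpow_neg_atTop (by linarith)).comp
        (tendsto_atTop_add_const_left _ _ tendsto_abs_atTop_atTop)
    simpa using (h1.const_mul M).mul_const |b - a|
  have hdiff : Tendsto (fun T : ℝ ↦ (∫ y in (-T)..T, f (b + y * I)) -
      ∫ y in (-T)..T, f (a + y * I)) atTop (𝓝 0) := by
    refine squeeze_zero_norm (fun T ↦ ?_) (by simpa using hzero.add hzero)
    have hrect := Complex.integral_boundary_rect_eq_zero_of_differentiableOn f
      (a + (-T : ℝ) * I) (b + T * I) (fun z hz ↦ by
        rw [mem_reProdIm] at hz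
        simp only [add_re, ofReal_re, mul_re, I_re, mul_zero, ofReal_im, I_im, mul_one, sub_self,
          add_zero, uIcc_of_le hab] at hz
        exact (hd z hz.1.1 hz.1.2).differentiableWithinAt)
    simp only [add_re, ofReal_re, mul_re, I_re, mul_zero, ofReal_im, I_im, mul_one, sub_self,
      add_zero, add_im, mul_im, zero_add, smul_eq_mul] at hrect
    have h2 : (∫ y in (-T)..T, f (b + y * I)) - ∫ y in (-T)..T, f (a + y * I) =
        I * ((∫ t in a..b, f (t + (-T : ℝ) * I)) - ∫ t in a..b, f (t + T * I)) := by
      linear_combination (-I) * hrect +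
        ((∫ y in (-T)..T, f (b + y * I)) - ∫ y in (-T)..T, f (a + y * I)) * I_sq
    rw [h2, norm_mul, norm_I, one_mul]
    refine (norm_sub_le _ _).trans ?_
    have h3 := hhor (-T)
    rw [abs_neg] at h3
    exact add_le_add h3 (hhor T)
  have h := (hlim b hab le_rfl).sub (hlim a le_rfl hab)
  exact (sub_eq_zero.mp (tendsto_nhds_unique h hdiff)).symm

lemma norm_inv_mul_logDeriv_le {A : ℝ}
    (hb : ∀ s : ℂ, 3 / 5 ≤ s.re → s.re ≤ 2 →
      ‖deriv regZeta s / regZeta s‖ ≤ A * (1 + |s.im|) ^ (1 / 20 : ℝ)) {w : ℂ}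
    (h1 : 3 / 5 ≤ w.re) (h2 : w.re ≤ 2) :
    ‖(w * (w + 1))⁻¹ * (deriv regZeta w / regZeta w)‖ ≤
      16 * A * (1 + |w.im|) ^ (-(39 / 20) : ℝ) := by
  rw [norm_mul]
  have h1 := norm_inv_mul_add_one_le h1
  have h2 := hb w ‹_› h2
  calc _ ≤ (16 * (1 + |w.im|) ^ (-2 : ℝ)) * (A * (1 + |w.im|) ^ (1 / 20 : ℝ)) := by gcongr
    _ = 16 * A * ((1 + |w.im|) ^ (-2 : ℝ) * (1 + |w.im|) ^ (1 / 20 : ℝ)) := by ring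
    _ = _ := by
      rw [← Real.rpow_add (by positivity)]
      norm_num

lemma smoothedPsi_sub_eq_integral_shifted
    (hRH : ∀ s : ℂ, riemannZeta s = 0 → 0 < s.re → s.re < 1 → s.re = 1 / 2)
    {x : ℝ} (hx : 0 < x) :
    ((smoothedPsi x - max (x - 1) 0 ^ 2 / 2 : ℝ) : ℂ) =
      -((1 / (2 * Real.pi)) • ∫ y : ℝ, (x : ℂ) ^ ((3 / 5 : ℝ) + y * I + 1 : ℂ) *
        ((((3 / 5 : ℝ) + y * I : ℂ) * ((3 / 5 : ℝ) + y * I + 1))⁻¹ *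
          (deriv regZeta ((3 / 5 : ℝ) + y * I) / regZeta ((3 / 5 : ℝ) + y * I)))) := by
  obtain ⟨A, hA, hb⟩ := exists_norm_logDeriv_regZeta_le hRH
  have hx0 : (x : ℂ) ≠ 0 := by exact_mod_cast hx.ne'
  rw [smoothedPsi_sub_eq_integral hRH hx]
  have h := integral_vertical_eq_of_norm_le (a := 3 / 5) (b := 2) (q := 39 / 20)
    (M := (1 + x) ^ (3 : ℝ) * (16 * A)) (f := fun w ↦ (x : ℂ) ^ (w + 1) *
      ((w * (w + 1))⁻¹ * (deriv regZeta w / regZeta w))) (by norm_num) (by norm_num)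
    (fun z h1 h2 ↦ by
      have hz : regZeta z ≠ 0 := regZeta_ne_zero hRH (by linarith)
      have hz0 : z ≠ 0 := by rintro rfl; norm_num at h1
      have hz1 : z + 1 ≠ 0 := fun h ↦ by
        have := congrArg Complex.re h
        simp at this; linarith
      have hd : DifferentiableAt ℂ (deriv regZeta) z :=
        (differentiable_regZeta.differentiableOn.deriv isOpen_univ).differentiableAt univ_mem
      refine DifferentiableAt.mul ?_ (DifferentiableAt.mul ?_ (hd.div (differentiable_regZeta z) hz))
      · exact DifferentiableAt.const_cpow (by fun_prop) (Or.inl hx0)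
      · exact DifferentiableAt.inv (by fun_prop) (mul_ne_zero hz0 hz1))
    (fun z h1 h2 ↦ by
      rw [norm_mul, mul_assoc]
      refine mul_le_mul ?_ (norm_inv_mul_logDeriv_le hb h1 h2) (norm_nonneg _) (by positivity)
      rw [norm_cpow_eq_rpow_re_of_pos hx]
      simp only [add_re, one_re]
      calc x ^ (z.re + 1) ≤ (1 + x) ^ (z.re + 1) :=
            Real.rpow_le_rpow hx.le (by linarith) (by linarith)
        _ ≤ _ := Real.rpow_le_rpow_of_exponent_le (by linarith) (by linarith))
  rw [h]
  congr 3
  ext y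
  push_cast
  ring_nf

lemma norm_cpow_sub_cpow_le {a b : ℝ} (ha : 0 < a) (hab : a ≤ b) {u : ℂ} (hu : u.re = 8 / 5) :
    ‖(b : ℂ) ^ u - (a : ℂ) ^ u‖ ≤
      2 * (b - a) ^ (9 / 10 : ℝ) * b ^ (7 / 10 : ℝ) * ‖u‖ ^ (9 / 10 : ℝ) := by
  have hb : 0 < b := ha.trans_le hab
  have hu0 : u ≠ 0 := by rintro rfl; norm_num at hu
  have h1 : ‖(b : ℂ) ^ u - (a : ℂ) ^ u‖ ≤ ‖u‖ * b ^ (3 / 5 : ℝ) * (b - a) := by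
    have := Convex.norm_image_sub_le_of_norm_hasDerivWithin_le (f := fun t : ℝ ↦ (t : ℂ) ^ u)
      (f' := fun t : ℝ ↦ u * (t : ℂ) ^ (u - 1)) (C := ‖u‖ * b ^ (3 / 5 : ℝ)) (s := Icc a b)
      (x := a) (y := b) (fun t ht ↦ ?_) (fun t ht ↦ ?_) (convex_Icc a b) (left_mem_Icc.mpr hab)
      (right_mem_Icc.mpr hab)
    · simpa [abs_of_nonneg (sub_nonneg.mpr hab)] using this
    · have ht0 : 0 < t := ha.trans_le ht.1
      exact (hasDerivAt_ofReal_cpow_const ht0.ne' hu0).hasDerivWithinAt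
    · have ht0 : 0 < t := ha.trans_le ht.1
      rw [norm_mul, norm_cpow_eq_rpow_re_of_pos ht0]
      gcongr
      rw [sub_re, hu, one_re, show (8 / 5 - 1 : ℝ) = 3 / 5 by norm_num]
      exact Real.rpow_le_rpow ht0.le ht.2 (by norm_num)
  have h2 : ‖(b : ℂ) ^ u - (a : ℂ) ^ u‖ ≤ 2 * b ^ (8 / 5 : ℝ) := by
    refine (norm_sub_le _ _).trans ?_
    rw [norm_cpow_eq_rpow_re_of_pos ha, norm_cpow_eq_rpow_re_of_pos hb, hu, two_mul]
    gcongr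
  set N := ‖(b : ℂ) ^ u - (a : ℂ) ^ u‖ with hN
  have hba : 0 ≤ b - a := sub_nonneg.mpr hab
  have hN0 : 0 ≤ N := norm_nonneg _
  calc N = N ^ (9 / 10 : ℝ) * N ^ (1 / 10 : ℝ) := by
        rw [← Real.rpow_add_of_nonneg hN0 (by norm_num) (by norm_num)]; norm_num
    _ ≤ (‖u‖ * b ^ (3 / 5 : ℝ) * (b - a)) ^ (9 / 10 : ℝ) * (2 * b ^ (8 / 5 : ℝ)) ^ (1 / 10 : ℝ) := by
        gcongr
    _ = (2 : ℝ) ^ (1 / 10 : ℝ) * (b - a) ^ (9 / 10 : ℝ) * (b ^ (27 / 50 : ℝ) * b ^ (4 / 25 : ℝ)) *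
        ‖u‖ ^ (9 / 10 : ℝ) := by
        rw [Real.mul_rpow (by positivity) hba, Real.mul_rpow (by positivity) (by positivity),
          Real.mul_rpow (by positivity) (by positivity), ← Real.rpow_mul hb.le,
          ← Real.rpow_mul hb.le]
        norm_num
        ring
    _ ≤ _ := by
        rw [← Real.rpow_add hb]
        norm_num
        gcongr
        calc (2 : ℝ) ^ (1 / 10 : ℝ) ≤ 2 ^ (1 : ℝ) :=
              Real.rpow_le_rpow_of_exponent_le (by norm_num) (by norm_num)
          _ = 2 := by norm_num

lemma exists_smoothedPsi_sub_le
    (hRH : ∀ s : ℂ, riemannZeta s = 0 → 0 < s.re → s.re < 1 → s.re = 1 / 2) :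
    ∃ K : ℝ, 0 < K ∧ ∀ x h : ℝ, 0 < x → 0 ≤ h →
      |(smoothedPsi (x + h) - max (x + h - 1) 0 ^ 2 / 2) -
        (smoothedPsi x - max (x - 1) 0 ^ 2 / 2)| ≤
      K * h ^ (9 / 10 : ℝ) * (x + h) ^ (7 / 10 : ℝ) := by
  obtain ⟨A, hA, hb⟩ := exists_norm_logDeriv_regZeta_le hRH
  set J : ℝ := ∫ y : ℝ, (1 + |y|) ^ (-(21 / 20) : ℝ) with hJ
  have hJint : Integrable fun y : ℝ ↦ (1 + |y|) ^ (-(21 / 20) : ℝ) := by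
    have := integrable_one_add_norm (E := ℝ) (μ := volume) (r := 21 / 20) (by norm_num)
    simpa using this
  have hJ0 : 0 ≤ J := integral_nonneg fun y ↦ by positivity
  set B : ℝ := 128 * A with hB
  refine ⟨B * J + 1, by positivity, fun x h hx hh ↦ ?_⟩
  have hxh : 0 < x + h := by linarith
  set F : ℝ → ℂ := fun y ↦ (((3 / 5 : ℝ) + y * I : ℂ) * ((3 / 5 : ℝ) + y * I + 1))⁻¹ *
    (deriv regZeta ((3 / 5 : ℝ) + y * I) / regZeta ((3 / 5 : ℝ) + y * I)) with hF
  have hFc : Continuous F := by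
    refine Continuous.mul ?_ (continuous_logDeriv_regZeta_line fun y ↦
          regZeta_ne_zero hRH (by norm_num))
    refine Continuous.inv₀ (by fun_prop) fun y ↦ mul_ne_zero ?_ ?_
    · exact line_ne_zero _ (by norm_num) y
    · have := line_ne_zero (8 / 5) (by norm_num) y
      convert this using 1; push_cast; ring
  have hFi : Integrable F := by
    refine integrable_of_norm_le_rpow (C := 16 * A) (q := 39 / 20) hFc (by norm_num) fun y ↦ ?_
    have him : ((3 / 5 : ℝ) + y * I : ℂ).im = y := by simp
    have := norm_inv_mul_logDeriv_le hb (w := (3 / 5 : ℝ) + y * I) (by simp) (by norm_num)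
    rwa [him] at this
  have hInt : ∀ t : ℝ, 0 < t →
      Integrable fun y : ℝ ↦ (t : ℂ) ^ ((3 / 5 : ℝ) + y * I + 1 : ℂ) * F y := by
    intro t ht
    have ht0 : (t : ℂ) ≠ 0 := by exact_mod_cast ht.ne'
    refine hFi.bdd_mul (c := t ^ (8 / 5 : ℝ)) (Continuous.aestronglyMeasurable ?_)
      (ae_of_all _ fun y ↦ ?_)
    · exact Continuous.const_cpow (by fun_prop) (Or.inl ht0)
    · rw [norm_cpow_eq_rpow_re_of_pos ht]
      norm_num
  rw [← Real.norm_eq_abs, ← Complex.norm_real, ofReal_sub,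
    smoothedPsi_sub_eq_integral_shifted hRH hx, smoothedPsi_sub_eq_integral_shifted hRH hxh,
    ← neg_sub_neg, neg_neg, neg_neg, ← smul_sub, ← integral_sub (hInt x hx) (hInt _ hxh),
    norm_smul]
  have hbound : ∀ y : ℝ, ‖(x : ℂ) ^ ((3 / 5 : ℝ) + y * I + 1 : ℂ) * F y -
      ((x + h : ℝ) : ℂ) ^ ((3 / 5 : ℝ) + y * I + 1 : ℂ) * F y‖ ≤
      B * h ^ (9 / 10 : ℝ) * (x + h) ^ (7 / 10 : ℝ) * (1 + |y|) ^ (-(21 / 20) : ℝ) := by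
    intro y
    set w : ℂ := (3 / 5 : ℝ) + y * I with hw
    have hwre : w.re = 3 / 5 := by simp [hw]
    have hwim : w.im = y := by simp [hw]
    have h1 := norm_cpow_sub_cpow_le hx (le_add_of_nonneg_right hh) (u := w + 1)
      (by rw [add_re, hwre, one_re]; norm_num)
    rw [add_sub_cancel_left] at h1
    have h2 : ‖w + 1‖ ≤ 4 * (1 + |y|) := by
      calc ‖w + 1‖ ≤ ‖w‖ + 1 := by simpa using norm_add_le w 1
        _ ≤ (|w.re| + |w.im|) + 1 := by gcongr; exact norm_le_abs_re_add_abs_im w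
        _ ≤ _ := by
          rw [hwre, hwim, abs_of_pos (by norm_num)]
          linarith [abs_nonneg y]
    have h3 := norm_inv_mul_logDeriv_le hb hwre.ge (by rw [hwre]; norm_num)
    rw [hwim] at h3
    rw [← sub_mul, norm_mul, norm_sub_rev]
    calc _ ≤ (2 * h ^ (9 / 10 : ℝ) * (x + h) ^ (7 / 10 : ℝ) *
            (4 * (1 + |y|) ^ (9 / 10 : ℝ))) *
          (16 * A * (1 + |y|) ^ (-(39 / 20) : ℝ)) := by
          refine mul_le_mul (h1.trans ?_) h3 (norm_nonneg _) (by positivity)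
          gcongr
          calc ‖w + 1‖ ^ (9 / 10 : ℝ) ≤ (4 * (1 + |y|)) ^ (9 / 10 : ℝ) := by gcongr
            _ = 4 ^ (9 / 10 : ℝ) * (1 + |y|) ^ (9 / 10 : ℝ) :=
                Real.mul_rpow (by norm_num) (by positivity)
            _ ≤ 4 ^ (1 : ℝ) * (1 + |y|) ^ (9 / 10 : ℝ) := by
                gcongr <;> norm_num
            _ = _ := by norm_num
      _ = B * h ^ (9 / 10 : ℝ) * (x + h) ^ (7 / 10 : ℝ) *
          ((1 + |y|) ^ (9 / 10 : ℝ) * (1 + |y|) ^ (-(39 / 20) : ℝ)) := by rw [hB]; ring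
      _ = _ := by
          rw [← Real.rpow_add (by positivity)]
          norm_num
  have hI := norm_integral_le_of_norm_le (hJint.const_mul _) (ae_of_all _ hbound)
  rw [integral_const_mul] at hI
  have hpi : ‖1 / (2 * Real.pi)‖ ≤ 1 := by
    rw [Real.norm_of_nonneg (by positivity), div_le_one (by positivity)]
    linarith [Real.two_le_pi]
  calc _ ≤ 1 * (B * h ^ (9 / 10 : ℝ) * (x + h) ^ (7 / 10 : ℝ) * J) :=
        mul_le_mul hpi hI (norm_nonneg _) zero_le_one
    _ = (B * J) * h ^ (9 / 10 : ℝ) * (x + h) ^ (7 / 10 : ℝ) := by ring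
    _ ≤ _ := by gcongr; linarith

lemma smoothedPsi_eq_sum {x : ℝ} {N : ℕ} (hN : ⌊x⌋₊ ≤ N) :
    smoothedPsi x =
      ∑ n ∈ Finset.Ioc 0 N, ArithmeticFunction.vonMangoldt n * max (x - n) 0 := by
  refine tsum_eq_sum fun n hn ↦ ?_
  rcases Nat.eq_zero_or_pos n with rfl | hn0
  · simp
  have h1 : N < n := by
    by_contra! h
    exact hn (Finset.mem_Ioc.mpr ⟨hn0, h⟩)
  have h2 : x < n := (Nat.floor_lt' hn0.ne').mp (hN.trans_lt h1)
  rw [max_eq_right (by linarith), mul_zero]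

lemma smoothedPsi_add_sub_le {x h : ℝ} (hh : 0 ≤ h) :
    smoothedPsi (x + h) - smoothedPsi x ≤ h * Chebyshev.psi (x + h) := by
  rw [smoothedPsi_eq_sum le_rfl,
    smoothedPsi_eq_sum (x := x) (Nat.floor_mono (by linarith : x ≤ x + h)),
    Chebyshev.psi, ← Finset.sum_sub_distrib, Finset.mul_sum]
  refine Finset.sum_le_sum fun n _ ↦ ?_
  rw [← mul_sub, mul_comm]
  refine mul_le_mul_of_nonneg_right ?_ ArithmeticFunction.vonMangoldt_nonneg
  rw [sub_le_iff_le_add]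
  exact max_le (by linarith [le_max_left (x - n) 0]) (by positivity)

lemma le_smoothedPsi_add_sub {x h : ℝ} (hx : 0 ≤ x) (hh : 0 ≤ h) :
    h * Chebyshev.psi x ≤ smoothedPsi (x + h) - smoothedPsi x := by
  have hfl : ⌊x⌋₊ ≤ ⌊x + h⌋₊ := Nat.floor_mono (by linarith)
  rw [smoothedPsi_eq_sum le_rfl, smoothedPsi_eq_sum (x := x) hfl,
    Chebyshev.psi, ← Finset.sum_sub_distrib, Finset.mul_sum]
  calc _ ≤ ∑ n ∈ Finset.Ioc 0 ⌊x⌋₊, (ArithmeticFunction.vonMangoldt n * max (x + h - n) 0 -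
        ArithmeticFunction.vonMangoldt n * max (x - n) 0) := by
        refine Finset.sum_le_sum fun n hn ↦ ?_
        have hnx : (n : ℝ) ≤ x := (Nat.le_floor_iff hx).mp (Finset.mem_Ioc.mp hn).2
        rw [max_eq_left (by linarith), max_eq_left (by linarith)]
        exact (by ring : _ = _).le
    _ ≤ _ := by
        refine Finset.sum_le_sum_of_subset_of_nonneg (Finset.Ioc_subset_Ioc_right hfl)
          fun n _ _ ↦ ?_
        rw [← mul_sub]
        refine mul_nonneg ArithmeticFunction.vonMangoldt_nonneg (sub_nonneg.mpr ?_)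
        exact max_le_max_right _ (by linarith)

lemma exists_abs_psi_sub_le
    (hRH : ∀ s : ℂ, riemannZeta s = 0 → 0 < s.re → s.re < 1 → s.re = 1 / 2) :
    ∃ K : ℝ, 0 < K ∧ ∀ x : ℝ, 2 ≤ x → |Chebyshev.psi x - x| ≤ K * x ^ (13 / 20 : ℝ) := by
  obtain ⟨K, hK, hD⟩ := exists_smoothedPsi_sub_le hRH
  refine ⟨4 * K + 2, by positivity, fun x hx ↦ ?_⟩
  have hx0 : 0 < x := by linarith
  have hx1 : 1 ≤ x := by linarith
  set h : ℝ := x ^ (3 / 5 : ℝ) / 2 with hh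
  have hh0 : 0 < h := by positivity
  have hhx : h ≤ x / 2 := by
    have : x ^ (3 / 5 : ℝ) ≤ x ^ (1 : ℝ) := Real.rpow_le_rpow_of_exponent_le hx1 (by norm_num)
    rw [Real.rpow_one] at this
    linarith
  have hE : ∀ b : ℝ, 0 < b → b ≤ 2 * x →
      K * h ^ (9 / 10 : ℝ) * b ^ (7 / 10 : ℝ) ≤ h * (4 * K * x ^ (13 / 20 : ℝ)) := by
    intro b hb hb2
    calc K * h ^ (9 / 10 : ℝ) * b ^ (7 / 10 : ℝ)
        ≤ K * (x ^ (3 / 5 : ℝ)) ^ (9 / 10 : ℝ) * (2 * x) ^ (7 / 10 : ℝ) := by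
          gcongr
          rw [hh]; linarith [Real.rpow_nonneg hx0.le (3 / 5)]
      _ = K * 2 ^ (7 / 10 : ℝ) * (x ^ (27 / 50 : ℝ) * x ^ (7 / 10 : ℝ)) := by
          rw [Real.mul_rpow (by norm_num) hx0.le, ← Real.rpow_mul hx0.le]
          norm_num
          ring
      _ ≤ K * 2 ^ (1 : ℝ) * (x ^ (3 / 5 : ℝ) * x ^ (13 / 20 : ℝ)) := by
          rw [← Real.rpow_add hx0, ← Real.rpow_add hx0]
          refine mul_le_mul (mul_le_mul_of_nonneg_left ?_ hK.le) ?_ (by positivity) (by positivity)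
          · exact Real.rpow_le_rpow_of_exponent_le (by norm_num) (by norm_num)
          · exact Real.rpow_le_rpow_of_exponent_le hx1 (by norm_num)
      _ = _ := by
          rw [Real.rpow_one, hh]; ring
  have hhle : h + 1 ≤ 2 * x ^ (13 / 20 : ℝ) := by
    have h1 : x ^ (3 / 5 : ℝ) ≤ x ^ (13 / 20 : ℝ) :=
      Real.rpow_le_rpow_of_exponent_le hx1 (by norm_num)
    have h2 : 1 ≤ x ^ (13 / 20 : ℝ) := Real.one_le_rpow hx1 (by norm_num)
    linarith
  rw [abs_le]
  constructor
  · have h1 := hD (x - h) h (by linarith) hh0.le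
    have h2 := smoothedPsi_add_sub_le (x := x - h) hh0.le
    rw [sub_add_cancel] at h1 h2
    have h3 := (abs_le.mp (h1.trans (hE x hx0 (by linarith)))).1
    rw [max_eq_left (by linarith), max_eq_left (by linarith)] at h3
    have h4 : h * (x - h - 1 - 4 * K * x ^ (13 / 20 : ℝ)) ≤ h * Chebyshev.psi x := by
      nlinarith [sq_nonneg h]
    have h5 := le_of_mul_le_mul_left h4 hh0
    linarith
  · have h1 := hD x h hx0 hh0.le
    have h2 := le_smoothedPsi_add_sub hx0.le hh0.le
    have h3 := (abs_le.mp (h1.trans (hE (x + h) (by linarith) (by linarith)))).2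
    rw [max_eq_left (by linarith), max_eq_left (by linarith)] at h3
    have h4 : h * Chebyshev.psi x ≤ h * (x + h + 4 * K * x ^ (13 / 20 : ℝ)) := by
      nlinarith [sq_nonneg h]
    have h5 := le_of_mul_le_mul_left h4 hh0
    linarith

lemma exists_abs_theta_sub_le
    (hRH : ∀ s : ℂ, riemannZeta s = 0 → 0 < s.re → s.re < 1 → s.re = 1 / 2) :
    ∃ K : ℝ, 0 < K ∧ ∀ x : ℝ, 2 ≤ x → |Chebyshev.theta x - x| ≤ K * x ^ (13 / 20 : ℝ) := by
  obtain ⟨K, hK, hψ⟩ := exists_abs_psi_sub_le hRH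
  obtain ⟨C, hC⟩ := Chebyshev.psi_sub_theta_le_mul_sqrt
  refine ⟨K + |C|, by positivity, fun x hx ↦ ?_⟩
  have h1 : √x ≤ x ^ (13 / 20 : ℝ) := by
    rw [Real.sqrt_eq_rpow]
    exact Real.rpow_le_rpow_of_exponent_le (by linarith) (by norm_num)
  have h2 : |Chebyshev.theta x - Chebyshev.psi x| ≤ |C| * x ^ (13 / 20 : ℝ) := by
    rw [abs_sub_comm, abs_of_nonneg (sub_nonneg.mpr (Chebyshev.theta_le_psi x))]
    refine (hC x).trans ?_
    exact mul_le_mul (le_abs_self C) h1 (Real.sqrt_nonneg x) (abs_nonneg C)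
  calc _ ≤ |Chebyshev.theta x - Chebyshev.psi x| + |Chebyshev.psi x - x| := abs_sub_le _ _ _
    _ ≤ |C| * x ^ (13 / 20 : ℝ) + K * x ^ (13 / 20 : ℝ) := add_le_add h2 (hψ x hx)
    _ = _ := by ring

lemma integral_one_div_log_eq {x : ℝ} (hx : 2 ≤ x) :
    ∫ t in (2 : ℝ)..x, 1 / Real.log t =
      x / Real.log x - 2 / Real.log 2 + ∫ t in (2 : ℝ)..x, 1 / Real.log t ^ 2 := by
  have hlog : ∀ t ∈ uIcc 2 x, Real.log t ≠ 0 := by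
    intro t ht
    rw [uIcc_of_le hx] at ht
    exact (Real.log_pos (by linarith [ht.1])).ne'
  have ht0 : ∀ t ∈ uIcc 2 x, t ≠ 0 := by
    intro t ht
    rw [uIcc_of_le hx] at ht
    linarith [ht.1]
  have hi2 : IntervalIntegrable (fun t : ℝ ↦ 1 / Real.log t ^ 2) volume 2 x :=
    Chebyshev.intervalIntegrable_one_div_log_sq (by norm_num) (by linarith)
  have hi1 : IntervalIntegrable (fun t : ℝ ↦ 1 / Real.log t) volume 2 x :=
    ContinuousOn.intervalIntegrable <|
      continuousOn_const.div (Real.continuousOn_log.mono fun t ht ↦ ht0 t ht) hlog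
  have h := intervalIntegral.integral_eq_sub_of_hasDerivAt (a := 2) (b := x)
    (f := fun t ↦ t / Real.log t) (f' := fun t ↦ 1 / Real.log t - 1 / Real.log t ^ 2)
    (fun t ht ↦ by
      have hd : HasDerivAt (fun t ↦ t / Real.log t)
          ((1 * Real.log t - t * t⁻¹) / Real.log t ^ 2) t :=
        (hasDerivAt_id t).div (Real.hasDerivAt_log (ht0 t ht)) (hlog t ht)
      have h1 : (1 * Real.log t - t * t⁻¹) / Real.log t ^ 2 =
          1 / Real.log t - 1 / Real.log t ^ 2 := by
        have := hlog t ht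
        rw [mul_inv_cancel₀ (ht0 t ht)]
        field_simp
      rwa [h1] at hd) (hi1.sub hi2)
  rw [intervalIntegral.integral_sub hi1 hi2] at h
  linarith

/-- Under the Riemann hypothesis, the prime counting function is `Li` up to a power saving. -/
lemma exists_abs_primeCounting_sub_Li_le
    (hRH : ∀ s : ℂ, riemannZeta s = 0 → 0 < s.re → s.re < 1 → s.re = 1 / 2) :
    ∃ C : ℝ, 0 < C ∧ ∀ y : ℝ, 1 ≤ y →
      |(Nat.primeCounting ⌊y⌋₊ : ℝ) - Li y| ≤ C * y ^ (2 / 3 : ℝ) := by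
  obtain ⟨K, hK, hθ⟩ := exists_abs_theta_sub_le hRH
  refine ⟨20 * K + 4, by positivity, fun x hx1 ↦ ?_⟩
  have hx0 : 0 < x := by linarith
  rcases lt_or_ge x 2 with hx | hx
  · have h1 : ⌊x⌋₊ = 1 := by
      rw [Nat.floor_eq_iff hx0.le]
      exact ⟨by simpa using hx1, by norm_num; exact hx⟩
    rw [h1, Li, if_pos hx.le]
    simp only [Nat.primeCounting_one, Nat.cast_zero, sub_zero, abs_zero]
    positivity
  have hl2 : 1 / 2 ≤ Real.log 2 := by linarith [Real.log_two_gt_d9]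
  have hl : ∀ t : ℝ, 2 ≤ t → 1 / 2 ≤ Real.log t := fun t ht ↦
    hl2.trans (Real.log_le_log (by norm_num) ht)
  have hLi : Li x = ∫ t in (2 : ℝ)..x, 1 / Real.log t := by
    rw [Li]
    split_ifs with h
    · rw [le_antisymm h hx, intervalIntegral.integral_same]
    · rfl
  have hi1 : IntervalIntegrable (fun t ↦ Chebyshev.theta t / (t * Real.log t ^ 2)) volume 2 x := by
    rw [intervalIntegrable_iff_integrableOn_Icc_of_le hx]
    exact Chebyshev.integrableOn_theta_div_id_mul_log_sq x
  have hi2 : IntervalIntegrable (fun t : ℝ ↦ 1 / Real.log t ^ 2) volume 2 x :=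
    Chebyshev.intervalIntegrable_one_div_log_sq (by norm_num) (by linarith)
  have hbound : |∫ t in (2 : ℝ)..x, (Chebyshev.theta t / (t * Real.log t ^ 2) -
      1 / Real.log t ^ 2)| ≤ 8 * K * x ^ (13 / 20 : ℝ) := by
    have h1 := intervalIntegral.norm_integral_le_of_norm_le (μ := volume) hx
      (f := fun t ↦ Chebyshev.theta t / (t * Real.log t ^ 2) - 1 / Real.log t ^ 2)
      (g := fun t ↦ 4 * K * t ^ (-(7 / 20) : ℝ)) (ae_of_all _ fun t ht ↦ by
        have ht0 : 0 < t := by linarith [ht.1]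
        have hlt := hl t ht.1.le
        have heq : Chebyshev.theta t / (t * Real.log t ^ 2) - 1 / Real.log t ^ 2 =
            (Chebyshev.theta t - t) * (t⁻¹ * (Real.log t)⁻¹ ^ 2) := by
          have : Real.log t ≠ 0 := by linarith
          field_simp
        have h2 : (Real.log t)⁻¹ ≤ 2 := by
          rw [inv_le_comm₀ (by linarith) (by norm_num)]; linarith
        have h3 : 0 ≤ (Real.log t)⁻¹ := inv_nonneg.mpr (by linarith)
        rw [heq, norm_mul, Real.norm_eq_abs, Real.norm_of_nonneg (by positivity)]
        calc _ ≤ (K * t ^ (13 / 20 : ℝ)) * (t⁻¹ * 2 ^ 2) := by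
              gcongr
              exact hθ t ht.1.le
          _ = 4 * K * (t ^ (13 / 20 : ℝ) * t ^ (-1 : ℝ)) := by
              rw [Real.rpow_neg_one]; ring
          _ = _ := by
              rw [← Real.rpow_add ht0]; norm_num)
      ((intervalIntegral.intervalIntegrable_rpow' (by norm_num)).const_mul _)
    rw [Real.norm_eq_abs, intervalIntegral.integral_const_mul,
      integral_rpow (Or.inl (by norm_num))] at h1
    refine h1.trans ?_
    have h2 : (0 : ℝ) ≤ 2 ^ (-(7 / 20) + 1 : ℝ) := by positivity
    have h3 : (-(7 / 20) + 1 : ℝ) = 13 / 20 := by norm_num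
    rw [h3] at h2 ⊢
    have h4 : (x ^ (13 / 20 : ℝ) - 2 ^ (13 / 20 : ℝ)) / (13 / 20) ≤ 2 * x ^ (13 / 20 : ℝ) := by
      rw [div_le_iff₀ (by norm_num)]
      linarith [Real.rpow_nonneg hx0.le (13 / 20)]
    calc _ ≤ 4 * K * (2 * x ^ (13 / 20 : ℝ)) := by gcongr
      _ = _ := by ring
  rw [intervalIntegral.integral_sub hi1 hi2] at hbound
  have hfirst : |(Chebyshev.theta x - x) / Real.log x| ≤ 2 * K * x ^ (13 / 20 : ℝ) := by
    have hlx := hl x hx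
    rw [abs_div, abs_of_pos (by linarith : 0 < Real.log x), div_le_iff₀ (by linarith)]
    refine (hθ x hx).trans ?_
    have : 0 ≤ K * x ^ (13 / 20 : ℝ) := by positivity
    nlinarith
  have hconst : |2 / Real.log 2| ≤ 4 := by
    rw [abs_of_pos (by positivity), div_le_iff₀ (by linarith)]
    linarith
  have hexp : x ^ (13 / 20 : ℝ) ≤ x ^ (2 / 3 : ℝ) :=
    Real.rpow_le_rpow_of_exponent_le hx1 (by norm_num)
  have hone : 1 ≤ x ^ (2 / 3 : ℝ) := Real.one_le_rpow hx1 (by norm_num)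
  rw [Chebyshev.primeCounting_eq_theta_div_log_add_integral hx, hLi, integral_one_div_log_eq hx]
  set P := ∫ t in (2 : ℝ)..x, Chebyshev.theta t / (t * Real.log t ^ 2)
  set Q := ∫ t in (2 : ℝ)..x, 1 / Real.log t ^ 2
  calc _ = |(Chebyshev.theta x - x) / Real.log x + (P - Q) + 2 / Real.log 2| := by
        congr 1; ring
    _ ≤ |(Chebyshev.theta x - x) / Real.log x| + |P - Q| + |2 / Real.log 2| := abs_add_three _ _ _
    _ ≤ 2 * K * x ^ (13 / 20 : ℝ) + 8 * K * x ^ (13 / 20 : ℝ) + 4 := by gcongr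
    _ = 10 * (K * x ^ (13 / 20 : ℝ)) + 4 := by ring
    _ ≤ 10 * (K * x ^ (2 / 3 : ℝ)) + 4 := by gcongr
    _ ≤ _ := by nlinarith [mul_pos hK (zero_lt_one.trans_le hone)]

lemma riemannZeta_re_eq_of_LFunction {p : ℕ} [NeZero p]
    (h : ∀ ψ : DirichletCharacter ℂ p, ∀ s : ℂ,
      DirichletCharacter.LFunction ψ s = 0 → 0 < s.re → s.re < 1 → s.re = 1 / 2)
    (s : ℂ) (hs : riemannZeta s = 0) (h0 : 0 < s.re) (h1 : s.re < 1) : s.re = 1 / 2 := by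
  refine h 1 s ?_ h0 h1
  have hs1 : s ≠ 1 := by rintro rfl; simp at h1
  have := DirichletCharacter.LFunctionTrivChar_eq_mul_riemannZeta (N := p) hs1
  rwa [hs, mul_zero] at this

lemma sq_mul_cube_injective {q r q' r' : ℕ} (hr : r.Prime) (hq' : q'.Prime)
    (hr' : r'.Prime) (h : q ^ 2 * r ^ 3 = q' ^ 2 * r' ^ 3) : q = q' ∧ r = r' := by
  have hrr : r = r' := by
    have h1 : r ∣ q' ^ 2 * r' ^ 3 := h ▸ Dvd.dvd.mul_left (dvd_pow_self r (by norm_num)) _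
    rcases hr.dvd_mul.mp h1 with h2 | h2
    · have h3 : r = q' := (Nat.prime_dvd_prime_iff_eq hr hq').mp (hr.dvd_of_dvd_pow h2)
      subst h3
      have h4 : q ^ 2 * r = r' ^ 3 := by
        apply Nat.eq_of_mul_eq_mul_left (pow_pos hr.pos 2)
        rw [← h]; ring
      exact (Nat.prime_dvd_prime_iff_eq hr hr').mp
        (hr.dvd_of_dvd_pow (h4 ▸ Dvd.intro_left _ rfl))
    · exact (Nat.prime_dvd_prime_iff_eq hr hr').mp (hr.dvd_of_dvd_pow h2)
  subst hrr
  refine ⟨?_, rfl⟩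
  have := Nat.eq_of_mul_eq_mul_right (pow_pos hr.pos 3) h
  exact Nat.pow_left_injective (by norm_num : 2 ≠ 0) this

lemma le_rpow_div_rpow_iff {x : ℝ} (hx : 0 ≤ x) {q r : ℕ} (hr : 0 < r) :
    (q : ℝ) ≤ x ^ ((1 : ℝ) / 2) / (r : ℝ) ^ ((3 : ℝ) / 2) ↔ ((q ^ 2 * r ^ 3 : ℕ) : ℝ) ≤ x := by
  have hr0 : (0 : ℝ) < r := by exact_mod_cast hr
  have h1 : (x ^ ((1 : ℝ) / 2) / (r : ℝ) ^ ((3 : ℝ) / 2)) ^ 2 = x / (r : ℝ) ^ 3 := by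
    rw [div_pow, ← Real.rpow_mul_natCast hx, ← Real.rpow_mul_natCast hr0.le, ← Real.rpow_natCast]
    norm_num
  rw [← pow_le_pow_iff_left₀ (by positivity) (by positivity) (two_ne_zero), h1,
    le_div_iff₀ (by positivity)]
  push_cast
  rfl

lemma le_rpow_third_iff {x : ℝ} (hx : 0 ≤ x) (r : ℕ) :
    (r : ℝ) ≤ x ^ ((1 : ℝ) / 3) ↔ (r : ℝ) ^ 3 ≤ x := by
  have h1 : (x ^ ((1 : ℝ) / 3)) ^ 3 = x := by
    rw [← Real.rpow_mul_natCast hx]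
    norm_num
  rw [← pow_le_pow_iff_left₀ (by positivity) (by positivity) (three_ne_zero), h1]

open Classical in
lemma sum_memS_eq {x : ℝ} (hx : 0 ≤ x) (f : ℕ → ℂ) :
    (∑ m ∈ Finset.Icc 1 ⌊x⌋₊, if memS m then f m else 0) =
      ∑ r ∈ (Finset.Iic ⌊x ^ ((1 : ℝ) / 3)⌋₊).filter Nat.Prime,
        ∑ q ∈ (Finset.range (⌊x ^ ((1 : ℝ) / 2) / (r : ℝ) ^ ((3 : ℝ) / 2)⌋₊ + 1)).filter Nat.Prime,
          f (q ^ 2 * r ^ 3) := by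
  rw [← Finset.sum_filter, Finset.sum_sigma']
  symm
  refine Finset.sum_bij (fun a _ ↦ a.2 ^ 2 * a.1 ^ 3) ?_ ?_ ?_ (fun _ _ ↦ rfl)
  · rintro ⟨r, q⟩ ha
    simp only [Finset.mem_sigma, Finset.mem_filter, Finset.mem_Iic, Finset.mem_range,
      Nat.lt_succ_iff, Finset.mem_Icc] at ha ⊢
    obtain ⟨⟨_, hr⟩, hq, hqp⟩ := ha
    refine ⟨⟨Nat.mul_pos (pow_pos hqp.pos 2) (pow_pos hr.pos 3), ?_⟩, q, r, hqp, hr, rfl⟩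
    rw [Nat.le_floor_iff (by positivity), le_rpow_div_rpow_iff hx hr.pos] at hq
    exact Nat.le_floor hq
  · rintro ⟨r, q⟩ ha ⟨r', q'⟩ ha' h
    simp only [Finset.mem_sigma, Finset.mem_filter] at ha ha' h
    obtain ⟨h1, h2⟩ := sq_mul_cube_injective ha.1.2 ha'.2.2 ha'.1.2 h
    subst h1 h2
    rfl
  · intro m hm
    rw [Finset.mem_filter, Finset.mem_Icc] at hm
    obtain ⟨⟨_, hmx⟩, q, r, hq, hr, rfl⟩ := hm
    rw [Nat.le_floor_iff hx] at hmx
    refine ⟨⟨r, q⟩, ?_, rfl⟩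
    simp only [Finset.mem_sigma, Finset.mem_filter, Finset.mem_Iic, Finset.mem_range,
      Nat.lt_succ_iff]
    refine ⟨⟨Nat.le_floor ((le_rpow_third_iff hx r).mpr (le_trans ?_ hmx)), hr⟩,
      Nat.le_floor ((le_rpow_div_rpow_iff hx hr.pos).mpr hmx), hq⟩
    exact_mod_cast Nat.le_mul_of_pos_left _ (pow_pos hq.pos 2)

lemma char_sq_eq_one {p : ℕ} [Fact p.Prime] {χ : DirichletCharacter ℂ p} (hχ : χ ^ 2 = 1)
    {q : ℕ} (hq : q.Prime) (hqp : q ≠ p) : χ (q : ZMod p) ^ 2 = 1 := by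
  have hu : IsUnit (q : ZMod p) :=
    (ZMod.isUnit_iff_coprime q p).mpr ((Nat.coprime_primes hq Fact.out).mpr hqp)
  rw [← MulChar.pow_apply' χ two_ne_zero, hχ, MulChar.one_apply hu]

lemma char_self_eq_zero {p : ℕ} [Fact p.Prime] (χ : DirichletCharacter ℂ p) :
    χ (p : ZMod p) = 0 := by
  rw [ZMod.natCast_self]
  exact MulChar.map_zero χ

lemma char_sq_mul_cube {p : ℕ} [Fact p.Prime] {χ : DirichletCharacter ℂ p} (hχ : χ ^ 2 = 1)
    (q : ℕ) {r : ℕ} (hr : r.Prime) :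
    χ ((q ^ 2 * r ^ 3 : ℕ) : ZMod p) = χ (r : ZMod p) * χ (q : ZMod p) ^ 2 := by
  push_cast
  rw [map_mul, map_pow, map_pow]
  rcases eq_or_ne r p with rfl | hrp
  · rw [char_self_eq_zero]; ring
  · rw [pow_succ (χ (r : ZMod p)) 2, char_sq_eq_one hχ hr hrp]; ring

lemma norm_sum_char_sq_sub_le {p : ℕ} [Fact p.Prime] {χ : DirichletCharacter ℂ p}
    (hχ : χ ^ 2 = 1) (n : ℕ) :
    ‖∑ q ∈ (Finset.range (n + 1)).filter Nat.Prime, χ (q : ZMod p) ^ 2 -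
      (Nat.primeCounting n : ℂ)‖ ≤ 1 := by
  have hcard : (Nat.primeCounting n : ℂ) = ∑ q ∈ (Finset.range (n + 1)).filter Nat.Prime, 1 := by
    rw [Finset.sum_const, nsmul_one, Nat.primeCounting, Nat.primeCounting',
      Nat.count_eq_card_filter_range]
  have hterm : ∀ q ∈ (Finset.range (n + 1)).filter Nat.Prime,
      χ (q : ZMod p) ^ 2 - 1 = if q = p then (-1 : ℂ) else 0 := by
    intro q hq
    split_ifs with h
    · rw [h, char_self_eq_zero]; norm_num
    · rw [char_sq_eq_one hχ (Finset.mem_filter.mp hq).2 h, sub_self]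
  rw [hcard, ← Finset.sum_sub_distrib, Finset.sum_congr rfl hterm, Finset.sum_ite_eq']
  split_ifs <;> simp

lemma sum_prime_one_add_div_le {C x : ℝ} (hC : 0 ≤ C) (hx : 8 ≤ x) :
    ∑ r ∈ (Finset.Iic ⌊x ^ ((1 : ℝ) / 3)⌋₊).filter Nat.Prime,
      (1 + C * (x ^ ((1 : ℝ) / 3) / r)) ≤ (1 + 2 * C) * x ^ ((1 : ℝ) / 3) * Real.log x := by
  set R : ℝ := x ^ ((1 : ℝ) / 3) with hR
  have hR1 : 1 ≤ R := Real.one_le_rpow (by linarith) (by norm_num)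
  have hRx : R ≤ x := by
    calc R ≤ x ^ (1 : ℝ) := Real.rpow_le_rpow_of_exponent_le (by linarith) (by norm_num)
      _ = x := Real.rpow_one x
  have hlog : 1 ≤ Real.log x := by
    rw [Real.le_log_iff_exp_le (by linarith)]
    linarith [Real.exp_one_lt_d9]
  have hM : (⌊R⌋₊ : ℝ) ≤ R := Nat.floor_le (by linarith)
  have hM1 : 1 ≤ ⌊R⌋₊ := Nat.le_floor (by simpa using hR1)
  have hsub : (Finset.Iic ⌊R⌋₊).filter Nat.Prime ⊆ Finset.Icc 1 ⌊R⌋₊ := by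
    intro r hr
    rw [Finset.mem_filter, Finset.mem_Iic] at hr
    exact Finset.mem_Icc.mpr ⟨hr.2.pos, hr.1⟩
  have hharm : ∑ r ∈ Finset.Icc 1 ⌊R⌋₊, (r : ℝ)⁻¹ ≤ 1 + Real.log x := by
    have h1 := harmonic_le_one_add_log ⌊R⌋₊
    rw [harmonic_eq_sum_Icc] at h1
    push_cast at h1
    have h2 : Real.log ⌊R⌋₊ ≤ Real.log x :=
      Real.log_le_log (by exact_mod_cast hM1) (hM.trans hRx)
    linarith
  calc _ ≤ ∑ r ∈ Finset.Icc 1 ⌊R⌋₊, (1 + C * (R / r)) :=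
        Finset.sum_le_sum_of_subset_of_nonneg hsub fun r _ _ ↦ by positivity
    _ = ⌊R⌋₊ + C * R * ∑ r ∈ Finset.Icc 1 ⌊R⌋₊, (r : ℝ)⁻¹ := by
        rw [Finset.sum_add_distrib, Finset.mul_sum]
        simp [div_eq_mul_inv, mul_assoc]
    _ ≤ R + C * R * (1 + Real.log x) := by gcongr
    _ ≤ R * Real.log x + C * R * (Real.log x + Real.log x) := by
        gcongr
        exact le_mul_of_one_le_right (by linarith) hlog
    _ = _ := by ring

/-- The main estimate, for a fixed power-saving bound on `π - Li`. -/
lemma norm_sum_memS_sub_le {C : ℝ} (hC : 0 < C)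
    (hπ : ∀ y : ℝ, 1 ≤ y → |(Nat.primeCounting ⌊y⌋₊ : ℝ) - Li y| ≤ C * y ^ (2 / 3 : ℝ))
    {p : ℕ} [Fact p.Prime] {χ : DirichletCharacter ℂ p} (hχ : χ ^ 2 = 1) {x : ℝ} (hx : 8 ≤ x) :
    ‖(∑ r ∈ (Finset.Iic ⌊x ^ ((1 : ℝ) / 3)⌋₊).filter Nat.Prime,
        ∑ q ∈ (Finset.range (⌊x ^ ((1 : ℝ) / 2) / (r : ℝ) ^ ((3 : ℝ) / 2)⌋₊ + 1)).filter Nat.Prime,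
          χ ((q ^ 2 * r ^ 3 : ℕ) : ZMod p)) -
      ∑ r ∈ (Finset.Iic ⌊x ^ ((1 : ℝ) / 3)⌋₊).filter Nat.Prime,
        χ (r : ZMod p) * ((Li (x ^ ((1 : ℝ) / 2) / (r : ℝ) ^ ((3 : ℝ) / 2)) : ℝ) : ℂ)‖ ≤
      (1 + 2 * C) * x ^ ((1 : ℝ) / 3) * Real.log x := by
  have hx0 : 0 ≤ x := by linarith
  rw [← Finset.sum_sub_distrib]
  refine (norm_sum_le_of_le _ fun r hr ↦ ?_).trans (sum_prime_one_add_div_le hC.le hx)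
  rw [Finset.mem_filter, Finset.mem_Iic, Nat.le_floor_iff (by positivity),
    le_rpow_third_iff hx0] at hr
  obtain ⟨hrx, hr⟩ := hr
  have hr0 : (0 : ℝ) < r := by exact_mod_cast hr.pos
  set y : ℝ := x ^ ((1 : ℝ) / 2) / (r : ℝ) ^ ((3 : ℝ) / 2) with hy
  have hy1 : 1 ≤ y := by
    have := (le_rpow_div_rpow_iff (q := 1) hx0 hr.pos).mpr (by simpa using hrx)
    rwa [Nat.cast_one] at this
  have hyp : y ^ (2 / 3 : ℝ) = x ^ ((1 : ℝ) / 3) / r := by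
    rw [hy, Real.div_rpow (by positivity) (by positivity), ← Real.rpow_mul hx0,
      ← Real.rpow_mul hr0.le]
    norm_num
  have hLi := hπ y hy1
  rw [hyp] at hLi
  simp_rw [char_sq_mul_cube hχ _ hr]
  rw [← Finset.mul_sum, ← mul_sub, norm_mul]
  refine (mul_le_of_le_one_left (norm_nonneg _) (DirichletCharacter.norm_le_one χ _)).trans ?_
  have h2 : ‖(Nat.primeCounting ⌊y⌋₊ : ℂ) - (Li y : ℂ)‖ ≤ C * (x ^ ((1 : ℝ) / 3) / r) := by
    rw [← ofReal_natCast, ← ofReal_sub, norm_real, Real.norm_eq_abs]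
    exact hLi
  exact (norm_sub_le_norm_sub_add_norm_sub _ _ _).trans
    (add_le_add (norm_sum_char_sq_sub_le hχ ⌊y⌋₊) h2)

end

open Classical in
/-- Lemma 4: under GRH mod `p`, for `χ` mod `p` with `χ² = χ₀`, the sum of `χ` over members of
`S` up to `x` equals `∑_{r ≤ x^(1/3) prime} χ(r) Li(x^(1/2)/r^(3/2)) + O(x^(1/3) log x)`. -/
theorem S_char_sum_quadratic_GRH :
    ∃ C : ℝ, 0 < C ∧ ∀ (p : ℕ) [Fact p.Prime], Odd p →
      ∀ χ : DirichletCharacter ℂ p, χ ^ 2 = 1 →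
      (∀ ψ : DirichletCharacter ℂ p, ∀ s : ℂ,
        DirichletCharacter.LFunction ψ s = 0 → 0 < s.re → s.re < 1 → s.re = 1/2) →
      ∀ x : ℝ, 8 ≤ x →
        ‖(∑ m ∈ Finset.Icc 1 ⌊x⌋₊, if memS m then χ (m : ZMod p) else 0)
            - ∑ r ∈ Finset.Iic ⌊x ^ ((1 : ℝ)/3)⌋₊ |>.filter Nat.Prime,
                χ (r : ZMod p) * ((Li (x ^ ((1 : ℝ)/2) / (r : ℝ) ^ ((3 : ℝ)/2)) : ℝ) : ℂ)‖
          ≤ C * x ^ ((1 : ℝ)/3) * Real.log x := by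
  by_cases hRH : ∀ s : ℂ, riemannZeta s = 0 → 0 < s.re → s.re < 1 → s.re = 1 / 2
  · obtain ⟨C, hC, hπ⟩ := exists_abs_primeCounting_sub_Li_le hRH
    refine ⟨1 + 2 * C, by positivity, fun p _ _ χ hχ _ x hx ↦ ?_⟩
    have h := norm_sum_memS_sub_le hC hπ hχ hx
    rw [← sum_memS_eq (by linarith) fun m ↦ χ (m : ZMod p)] at h
    exact h
  · exact ⟨1, one_pos, fun p _ _ χ _ h ↦ absurd (riemannZeta_re_eq_of_LFunction h) hRH⟩
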